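/- Let γ be the standard Gaussian measure on ℝⁿ, and let K and L be origin-symmetric convex bodies in ℝⁿ both containing √((n+1)/2)·B₂ⁿ. Then for every λ ∈ [0,1], γ(λ·K +_0 (1−λ)·L) ≥ γ(K)^λ · γ(L)^{1−λ}; that is, the Gaussian Log-Brunn-Minkowski inequality holds for such K and L. -/

import Mathlib

open MeasureTheory
open scoped RealInnerProductSpace ENNReal

noncomputable section

abbrev Euc (n : ℕ) : Type := EuclideanSpace ℝ (Fin n)

/-- A convex body: a compact convex set with nonempty interior. -/
def IsConvexBody {n : ℕ} (K : Set (Euc n)) : Prop :=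
  IsCompact K ∧ Convex ℝ K ∧ (interior K).Nonempty

/-- The support function `h_K(u) = sup_{y ∈ K} ⟨u, y⟩`. -/
def suppFn {n : ℕ} (K : Set (Euc n)) (u : Euc n) : ℝ :=
  sSup ((fun y => ⟪u, y⟫) '' K)

/-- `lpComb p lam K L` is the `L_p` combination `lam·K +_p (1−lam)·L`;
for `p = 0` it is the logarithmic combination. -/
def lpComb {n : ℕ} (p lam : ℝ) (K L : Set (Euc n)) : Set (Euc n) :=
  if p = 0 then
    {x | ∀ u : Euc n, ‖u‖ = 1 → ⟪x, u⟫ ≤ suppFn K u ^ lam * suppFn L u ^ (1 - lam)}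
  else
    {x | ∀ u : Euc n, ‖u‖ = 1 →
      ⟪x, u⟫ ≤ (lam * suppFn K u ^ p + (1 - lam) * suppFn L u ^ p) ^ (1 / p)}


/-- The standard Gaussian measure on `ℝⁿ`, with density `(2π)^{-n/2} e^{-|x|²/2}`. -/
def gaussianMeasure (n : ℕ) : Measure (Euc n) :=
  volume.withDensity fun x =>
    ENNReal.ofReal ((2 * Real.pi) ^ (-(n : ℝ) / 2) * Real.exp (-‖x‖ ^ 2 / 2))

section

variable {n : ℕ}

/-- The partial derivative of `f` in the `i`-th coordinate direction. -/
def pd (i : Fin n) (f : Euc n → ℝ) (x : Euc n) : ℝ :=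
  fderiv ℝ f x (EuclideanSpace.single i 1)

/-- Smooth compactly supported functions. -/
def IsTest (u : Euc n → ℝ) : Prop :=
  ContDiff ℝ (⊤ : ℕ∞) u ∧ HasCompactSupport u

lemma contDiff_pd {f : Euc n → ℝ} {k m : WithTop ℕ∞} (hf : ContDiff ℝ m f) (h : k + 1 ≤ m)
    (i : Fin n) : ContDiff ℝ k (pd i f) :=
  (hf.fderiv_right h).clm_apply contDiff_const

lemma continuous_pd {f : Euc n → ℝ} (hf : ContDiff ℝ 1 f) (i : Fin n) : Continuous (pd i f) :=
  (contDiff_pd (k := 0) hf (by simp) i).continuous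

lemma HasCompactSupport.pd {f : Euc n → ℝ} (hf : HasCompactSupport f) (i : Fin n) :
    HasCompactSupport (pd i f) :=
  hf.fderiv_apply (𝕜 := ℝ) _

lemma IsTest.pd {u : Euc n → ℝ} (hu : IsTest u) (i : Fin n) : IsTest (pd i u) :=
  ⟨contDiff_pd hu.1 (by exact_mod_cast le_rfl) i, hu.2.pd i⟩

lemma IsTest.contDiff {u : Euc n → ℝ} (hu : IsTest u) (k : ℕ) : ContDiff ℝ k u :=
  hu.1.of_le (by exact_mod_cast le_top)

lemma IsTest.contDiff_one {u : Euc n → ℝ} (hu : IsTest u) : ContDiff ℝ 1 u := by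
  exact_mod_cast hu.contDiff 1

lemma IsTest.continuous {u : Euc n → ℝ} (hu : IsTest u) : Continuous u := hu.1.continuous

lemma IsTest.differentiable {u : Euc n → ℝ} (hu : IsTest u) : Differentiable ℝ u :=
  hu.contDiff_one.differentiable one_ne_zero

lemma pd_add {f g : Euc n → ℝ} {x : Euc n} (hf : DifferentiableAt ℝ f x)
    (hg : DifferentiableAt ℝ g x) (i : Fin n) :
    pd i (fun y => f y + g y) x = pd i f x + pd i g x := by
  simp [pd, fderiv_fun_add hf hg]

lemma pd_sub {f g : Euc n → ℝ} {x : Euc n} (hf : DifferentiableAt ℝ f x)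
    (hg : DifferentiableAt ℝ g x) (i : Fin n) :
    pd i (fun y => f y - g y) x = pd i f x - pd i g x := by
  simp [pd, fderiv_fun_sub hf hg]

lemma pd_mul {f g : Euc n → ℝ} {x : Euc n} (hf : DifferentiableAt ℝ f x)
    (hg : DifferentiableAt ℝ g x) (i : Fin n) :
    pd i (fun y => f y * g y) x = pd i f x * g x + f x * pd i g x := by
  simp [pd, fderiv_fun_mul hf hg]; ring

lemma pd_const_mul {f : Euc n → ℝ} {x : Euc n} (hf : DifferentiableAt ℝ f x) (c : ℝ)
    (i : Fin n) : pd i (fun y => c * f y) x = c * pd i f x := by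
  simp [pd, fderiv_const_mul hf]

lemma pd_sum {ι : Type*} {s : Finset ι} {f : ι → Euc n → ℝ} {x : Euc n}
    (hf : ∀ j ∈ s, DifferentiableAt ℝ (f j) x) (i : Fin n) :
    pd i (fun y => ∑ j ∈ s, f j y) x = ∑ j ∈ s, pd i (f j) x := by
  simp [pd, fderiv_fun_sum hf]

/-- One-dimensional chain rule for partial derivatives. -/
lemma pd_comp {f : Euc n → ℝ} {φ : ℝ → ℝ} {φ' : ℝ} {x : Euc n} (hφ : HasDerivAt φ φ' (f x))
    (hf : DifferentiableAt ℝ f x) (i : Fin n) :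
    pd i (fun y => φ (f y)) x = φ' * pd i f x := by
  have h := (hφ.comp_hasFDerivAt x hf.hasFDerivAt).fderiv
  have h' : fderiv ℝ (fun y => φ (f y)) x = φ' • fderiv ℝ f x := h
  simp [pd, h']

lemma pd_sub_left {u : Euc n → ℝ} (hu : Differentiable ℝ u) (x y : Euc n) (i : Fin n) :
    pd i (fun z => u (x - z)) y = -pd i u (x - y) := by
  have h := ((hu (x - y)).hasFDerivAt.comp y ((hasFDerivAt_id y).const_sub x)).fderiv
  have h' : fderiv ℝ (fun z => u (x - z)) y
      = (fderiv ℝ u (x - y)).comp (-ContinuousLinearMap.id ℝ (Euc n)) := h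
  simp [pd, h']

lemma pd_neg_arg {u : Euc n → ℝ} (hu : Differentiable ℝ u) (y : Euc n) (i : Fin n) :
    pd i (fun z => u (-z)) y = -pd i u (-y) := by
  simpa using pd_sub_left hu 0 y i

lemma pd_comm {f : Euc n → ℝ} (hf : ContDiff ℝ 2 f) (i j : Fin n) (x : Euc n) :
    pd i (pd j f) x = pd j (pd i f) x := by
  have hd : DifferentiableAt ℝ (fderiv ℝ f) x :=
    (hf.fderiv_right (m := 1) (by norm_num)).differentiable one_ne_zero x
  have key : ∀ i j : Fin n, pd i (pd j f) x = fderiv ℝ (fderiv ℝ f) x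
      (EuclideanSpace.single i 1) (EuclideanSpace.single j 1) := by
    intro i j
    have : pd j f = fun y => fderiv ℝ f y (EuclideanSpace.single j 1) := rfl
    rw [this]
    unfold pd
    rw [fderiv_clm_apply hd (differentiableAt_const _)]
    simp
  rw [key, key]
  have hs : IsSymmSndFDerivAt ℝ f x :=
    hf.contDiffAt.isSymmSndFDerivAt (by simp)
  exact hs _ _

lemma pd_coord (i j : Fin n) (x : Euc n) :
    pd i (fun y : Euc n => y j) x = if i = j then 1 else 0 := by
  have : fderiv ℝ (fun y : Euc n => y j) x = EuclideanSpace.proj j :=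
    (EuclideanSpace.proj (𝕜 := ℝ) j : Euc n →L[ℝ] ℝ).fderiv
  simp [pd, this, eq_comm]

lemma pd_inner (i : Fin n) (u x : Euc n) : pd i (fun y : Euc n => ⟪y, u⟫) x = u i := by
  have h : HasFDerivAt (fun y : Euc n => ⟪y, u⟫) (innerSL ℝ u) x := by
    simpa [real_inner_comm] using (innerSL ℝ u).hasFDerivAt (x := x)
  simp [pd, h.fderiv, EuclideanSpace.inner_single_right]

lemma integral_pd_mul {f g : Euc n → ℝ} (hf : ContDiff ℝ 1 f) (hg : ContDiff ℝ 1 g)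
    (hc : HasCompactSupport f ∨ HasCompactSupport g) (i : Fin n) :
    ∫ x, f x * pd i g x = -∫ x, pd i f x * g x := by
  have hint : ∀ a b : Euc n → ℝ, Continuous a → Continuous b →
      (HasCompactSupport a ∨ HasCompactSupport b) → Integrable (fun x => a x * b x) := by
    intro a b ha hb h
    refine (ha.mul hb).integrable_of_hasCompactSupport ?_
    rcases h with h | h
    · exact h.mul_right
    · exact h.mul_left
  refine integral_mul_fderiv_eq_neg_fderiv_mul_of_integrable ?_ ?_ ?_
    (fun x _ => hf.differentiable one_ne_zero x) (fun x _ => hg.differentiable one_ne_zero x)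
  · exact hint _ _ (continuous_pd hf i) hg.continuous (hc.imp_left fun h => h.pd i)
  · exact hint _ _ hf.continuous (continuous_pd hg i) (hc.imp_right fun h => h.pd i)
  · exact hint _ _ hf.continuous hg.continuous hc

/-! ### Convolution with test functions -/

/-- Convolution of real functions on Euclidean space. -/
def cv (H η : Euc n → ℝ) (x : Euc n) : ℝ := ∫ y, H y * η (x - y)

lemma cv_eq (H η : Euc n → ℝ) :
    cv H η = convolution H η (ContinuousLinearMap.mul ℝ ℝ) volume := rfl

lemma contDiff_cv {H η : Euc n → ℝ} (hH : LocallyIntegrable H) (hη : IsTest η) :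
    ContDiff ℝ (⊤ : ℕ∞) (cv H η) := by
  rw [cv_eq]
  exact hη.2.contDiff_convolution_right _ hH hη.1

lemma pd_cv {H η : Euc n → ℝ} (hH : LocallyIntegrable H) (hη : IsTest η) (i : Fin n)
    (x : Euc n) : pd i (cv H η) x = cv H (pd i η) x := by
  rw [cv_eq, cv_eq]
  unfold pd
  rw [(hη.2.hasFDerivAt_convolution_right _ hH hη.contDiff_one x).fderiv,
    convolution_precompR_apply _ hH (hη.2.fderiv ℝ)
      (hη.contDiff_one.continuous_fderiv one_ne_zero)]

lemma integrable_cv_integrand {H η : Euc n → ℝ} (hH : LocallyIntegrable H) (hη : Continuous η)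
    (hc : HasCompactSupport η) (x : Euc n) : Integrable (fun y => H y * η (x - y)) :=
  hc.convolutionExists_right (ContinuousLinearMap.mul ℝ ℝ) hH hη x

lemma IsTest.sub_left {η : Euc n → ℝ} (hη : IsTest η) (x : Euc n) :
    IsTest (fun y => η (x - y)) :=
  ⟨hη.1.comp (contDiff_const.sub contDiff_id),
    hη.2.comp_homeomorph (Homeomorph.subLeft x)⟩

lemma locallyIntegrable_mul_continuous {H k : Euc n → ℝ} (hH : LocallyIntegrable H)
    (hk : Continuous k) : LocallyIntegrable (fun x => H x * k x) := by
  rw [← locallyIntegrableOn_univ] at hH ⊢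
  exact hH.mul_continuousOn hk.continuousOn isOpen_univ.isLocallyClosed

/-- The measure with Lebesgue density `e^{-V}`. -/
def gibbs (V : Euc n → ℝ) : Measure (Euc n) :=
  volume.withDensity fun x => ENNReal.ofReal (Real.exp (-V x))

/-- The generator `Δu - ⟨∇V, ∇u⟩`. -/
def genL (V u : Euc n → ℝ) (x : Euc n) : ℝ :=
  ∑ i, (pd i (pd i u) x - pd i V x * pd i u x)

lemma measurable_gibbs_density {V : Euc n → ℝ} (hV : Continuous V) :
    Measurable fun x => ENNReal.ofReal (Real.exp (-V x)) :=
  (Real.continuous_exp.comp hV.neg).measurable.ennreal_ofReal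

lemma integral_gibbs {V : Euc n → ℝ} (hV : Continuous V) (f : Euc n → ℝ) :
    ∫ x, f x ∂(gibbs V) = ∫ x, f x * Real.exp (-V x) := by
  rw [gibbs, integral_withDensity_eq_integral_toReal_smul (measurable_gibbs_density hV)
    (by simp)]
  refine integral_congr_ae (.of_forall fun x => ?_)
  simp [ENNReal.toReal_ofReal (Real.exp_pos _).le, mul_comm]

lemma integrable_gibbs {V : Euc n → ℝ} (hV : Continuous V) {f : Euc n → ℝ} :
    Integrable f (gibbs V) ↔ Integrable (fun x => f x * Real.exp (-V x)) := by
  rw [gibbs, integrable_withDensity_iff (measurable_gibbs_density hV) (by simp)]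
  refine integrable_congr (.of_forall fun x => ?_)
  simp [ENNReal.toReal_ofReal (Real.exp_pos _).le]

lemma ae_gibbs {V : Euc n → ℝ} (hV : Continuous V) {p : Euc n → Prop} :
    (∀ᵐ x ∂(gibbs V), p x) ↔ ∀ᵐ x, p x := by
  rw [gibbs, ae_withDensity_iff (measurable_gibbs_density hV)]
  simp [Real.exp_pos]

/-- Weighted Jensen inequality against a mollifier. -/
lemma sq_cv_le {V h k η : Euc n → ℝ} (hV : Continuous V) (hk : Continuous k)
    (h1 : LocallyIntegrable (fun y => h y * Real.exp (-V y)))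
    (h2 : LocallyIntegrable (fun y => h y ^ 2 * Real.exp (-V y)))
    (hη : IsTest η) (hη0 : ∀ y, 0 ≤ η y) (hη1 : ∫ y, η y = 1) {x : Euc n} {ω : ℝ}
    (hVx : ∀ y, η (x - y) ≠ 0 → V x - V y ≤ 1)
    (hkx : ∀ y, η (x - y) ≠ 0 → |k y| ≤ ω) :
    cv (fun y => h y * Real.exp (-V y) * k y) η x ^ 2 * Real.exp (V x)
      ≤ Real.exp 1 * ω ^ 2 * cv (fun y => h y ^ 2 * Real.exp (-V y)) η x := by
  set T := cv (fun y => h y * Real.exp (-V y) * k y) η x with hT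
  have hE : Continuous fun y => Real.exp (-V y) := by fun_prop
  have i1 : Integrable (fun y => h y * Real.exp (-V y) * k y * η (x - y)) :=
    integrable_cv_integrand (locallyIntegrable_mul_continuous h1 hk) hη.continuous hη.2 x
  have i2 : Integrable (fun y => h y ^ 2 * Real.exp (-V y) * (Real.exp (-V y) * k y ^ 2)
      * η (x - y)) :=
    integrable_cv_integrand (locallyIntegrable_mul_continuous h2 (by fun_prop)) hη.continuous hη.2 x
  have i3 : Integrable (fun y => η (x - y)) :=
    (hη.sub_left x).continuous.integrable_of_hasCompactSupport (hη.sub_left x).2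
  have i4 : Integrable (fun y => h y ^ 2 * Real.exp (-V y) * η (x - y)) :=
    integrable_cv_integrand h2 hη.continuous hη.2 x
  have e3 : ∫ y, η (x - y) = 1 := by rw [integral_sub_left_eq_self η volume x, hη1]
  have i5 : Integrable (fun y => h y ^ 2 * Real.exp (-V y) * (Real.exp (-V y) * k y ^ 2)
      * η (x - y) - 2 * T * (h y * Real.exp (-V y) * k y * η (x - y))) :=
    i2.sub (i1.const_mul _)
  have key : T ^ 2 ≤ ∫ y, h y ^ 2 * Real.exp (-V y) * (Real.exp (-V y) * k y ^ 2) * η (x - y) := by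
    have h0 : 0 ≤ ∫ y, (h y * Real.exp (-V y) * k y - T) ^ 2 * η (x - y) :=
      integral_nonneg fun y => mul_nonneg (sq_nonneg _) (hη0 _)
    have e : ∫ y, (h y * Real.exp (-V y) * k y - T) ^ 2 * η (x - y)
        = (∫ y, h y ^ 2 * Real.exp (-V y) * (Real.exp (-V y) * k y ^ 2) * η (x - y))
          - 2 * T * (∫ y, h y * Real.exp (-V y) * k y * η (x - y))
          + T ^ 2 * ∫ y, η (x - y) := by
      rw [← integral_const_mul, ← integral_const_mul, ← integral_sub i2 (i1.const_mul _),
        ← integral_add i5 (i3.const_mul _)]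
      refine integral_congr_ae (.of_forall fun y => ?_)
      simp only
      ring
    have e1 : ∫ y, h y * Real.exp (-V y) * k y * η (x - y) = T := rfl
    rw [e, e1, e3] at h0
    nlinarith
  have le : ∫ y, h y ^ 2 * Real.exp (-V y) * (Real.exp (-V y) * k y ^ 2) * η (x - y)
      ≤ ∫ y, (Real.exp 1 * Real.exp (-V x) * ω ^ 2)
        * (h y ^ 2 * Real.exp (-V y) * η (x - y)) := by
    refine integral_mono i2 (i4.const_mul _) fun y => ?_
    simp only
    by_cases hy : η (x - y) = 0
    · simp [hy]
    have hω : k y ^ 2 ≤ ω ^ 2 := by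
      rw [← sq_abs]; gcongr; exact hkx y hy
    have hv : Real.exp (-V y) ≤ Real.exp 1 * Real.exp (-V x) := by
      rw [← Real.exp_add]; gcongr; linarith [hVx y hy]
    have hm : Real.exp (-V y) * k y ^ 2 ≤ Real.exp 1 * Real.exp (-V x) * ω ^ 2 := by gcongr
    have h0 : 0 ≤ h y ^ 2 * Real.exp (-V y) * η (x - y) :=
      mul_nonneg (by positivity) (hη0 _)
    nlinarith [mul_le_mul_of_nonneg_left hm h0]
  rw [integral_const_mul] at le
  calc T ^ 2 * Real.exp (V x)
      ≤ (Real.exp 1 * Real.exp (-V x) * ω ^ 2 *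
        ∫ y, h y ^ 2 * Real.exp (-V y) * η (x - y)) * Real.exp (V x) := by
        gcongr; exact key.trans le
    _ = Real.exp 1 * ω ^ 2 * (∫ y, h y ^ 2 * Real.exp (-V y) * η (x - y))
        * (Real.exp (-V x) * Real.exp (V x)) := by ring
    _ = _ := by rw [← Real.exp_add]; simp [cv]

/-- The mollified Fokker–Planck equation. -/
lemma sum_cv_eq_zero {V h η : Euc n → ℝ} (hV : ContDiff ℝ 1 V)
    (h1 : LocallyIntegrable (fun y => h y * Real.exp (-V y)))
    (hL : ∀ u, IsTest u → ∫ x, h x * genL V u x ∂(gibbs V) = 0) (hη : IsTest η) (x : Euc n) :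
    ∑ i, (cv (fun y => h y * Real.exp (-V y)) (pd i (pd i η)) x
      + cv (fun y => h y * Real.exp (-V y) * pd i V y) (pd i η) x) = 0 := by
  have := hL _ (hη.sub_left x)
  rw [integral_gibbs hV.continuous] at this
  rw [← this]
  have hd : ∀ i, pd i (fun y => η (x - y)) = fun y => -pd i η (x - y) := fun i => by
    ext y; exact pd_sub_left hη.differentiable x y i
  have hdd : ∀ i y, pd i (pd i (fun y => η (x - y))) y = pd i (pd i η) (x - y) := fun i y => by
    rw [hd i]
    have h2 := pd_sub_left (hη.pd i).differentiable x y i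
    have h3 := pd_const_mul (f := fun y => pd i η (x - y))
      ((hη.pd i).sub_left x).differentiable.differentiableAt (-1) (x := y) i
    simp only [neg_mul, one_mul] at h3
    rw [h3, h2, neg_neg]
  have i1 : ∀ i, Integrable (fun y => h y * Real.exp (-V y) * pd i (pd i η) (x - y)) := fun i =>
    integrable_cv_integrand h1 ((hη.pd i).pd i).continuous ((hη.pd i).pd i).2 x
  have i2 : ∀ i, Integrable (fun y => h y * Real.exp (-V y) * pd i V y * pd i η (x - y)) :=
    fun i => integrable_cv_integrand (locallyIntegrable_mul_continuous h1 (continuous_pd hV i))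
      (hη.pd i).continuous (hη.pd i).2 x
  have i3 : ∀ i, Integrable (fun y => h y * Real.exp (-V y) * pd i (pd i η) (x - y)
      + h y * Real.exp (-V y) * pd i V y * pd i η (x - y)) := fun i => (i1 i).add (i2 i)
  unfold cv
  simp_rw [← integral_add (i1 _) (i2 _)]
  rw [← integral_finsetSum _ fun i _ => i3 i]
  refine integral_congr_ae (.of_forall fun y => ?_)
  simp only [genL, hdd, Finset.mul_sum, Finset.sum_mul]
  refine Finset.sum_congr rfl fun i _ => ?_
  rw [hd i]
  ring

lemma integrable_mul_compact {a b : Euc n → ℝ} (ha : Continuous a) (hb : Continuous b)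
    (h : HasCompactSupport b) : Integrable (fun x => a x * b x) :=
  (ha.mul hb).integrable_of_hasCompactSupport h.mul_left

lemma energy_quadratic_bound {ρ E χ χ' N G g R B κ τ : ℝ} (hρ : 0 < ρ) (hρE : ρ * E = 1)
    (hχ : |χ| ≤ 1) (hχ' : |χ'| ≤ κ) (hG : G = N * E)
    (hN : N ^ 2 * E ≤ Real.exp 1 * B) (hR : R ^ 2 * E ≤ Real.exp 1 * τ ^ 2 * B) :
    1 / 2 * (χ ^ 2 * g ^ 2 * ρ) - Real.exp 1 * (5 * κ ^ 2 + 2 * τ ^ 2) * B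
      ≤ (ρ * g + R) * (2 * χ * χ' * G + χ ^ 2 * g) := by
  have hE : 0 < E := by
    by_contra h
    nlinarith [mul_nonneg hρ.le (sub_nonneg.2 (not_lt.1 h))]
  have h1 : 0 ≤ ρ * (1 / 2 * (χ * g + 2 * (χ' * G) + χ * R * E) ^ 2 + 3 * (χ' * G) ^ 2
      + 3 / 2 * (χ * R * E) ^ 2) := by positivity
  have hχ2 : χ ^ 2 ≤ 1 := by rw [← sq_abs]; nlinarith [abs_nonneg χ]
  have hχ'2 : χ' ^ 2 ≤ κ ^ 2 := by rw [← sq_abs]; gcongr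
  have h2 : χ ^ 2 * (R ^ 2 * E) ≤ Real.exp 1 * τ ^ 2 * B :=
    (mul_le_of_le_one_left (by positivity) hχ2).trans hR
  have h3 : χ' ^ 2 * (N ^ 2 * E) ≤ κ ^ 2 * (Real.exp 1 * B) := by gcongr
  have e1 : ρ * (1 / 2 * (χ * g + 2 * (χ' * G) + χ * R * E) ^ 2 + 3 * (χ' * G) ^ 2
      + 3 / 2 * (χ * R * E) ^ 2) = (ρ * g + R) * (2 * χ * χ' * G + χ ^ 2 * g)
      - 1 / 2 * (χ ^ 2 * g ^ 2 * ρ) + 5 * (χ' ^ 2 * (N ^ 2 * E)) + 2 * (χ ^ 2 * (R ^ 2 * E)) := by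
    subst hG
    linear_combination (χ * g * χ * R + 2 * (χ' * N * E) * (χ * R)
      + 2 * χ ^ 2 * R ^ 2 * E + 5 * χ' ^ 2 * N ^ 2 * E) * hρE
  nlinarith

/-- Caccioppoli-type estimate for the mollified solution of the stationary equation. -/
lemma energy_estimate {V h χ η : Euc n → ℝ} (hV : ContDiff ℝ 1 V)
    (h1 : Integrable (fun y => h y * Real.exp (-V y)))
    (h2 : Integrable (fun y => h y ^ 2 * Real.exp (-V y)))
    (hL : ∀ u, IsTest u → ∫ x, h x * genL V u x ∂(gibbs V) = 0)
    (hη : IsTest η) (hη0 : ∀ y, 0 ≤ η y) (hη1 : ∫ y, η y = 1)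
    (hχ : IsTest χ) (hχ1 : ∀ x, |χ x| ≤ 1) {κ τ : ℝ} (hχκ : ∀ i x, |pd i χ x| ≤ κ)
    (hVx : ∀ x ∈ tsupport χ, ∀ y, η (x - y) ≠ 0 → V x - V y ≤ 1)
    (hVix : ∀ x ∈ tsupport χ, ∀ y, η (x - y) ≠ 0 → ∀ i, |pd i V y - pd i V x| ≤ τ) :
    ∑ i, ∫ x, χ x ^ 2
        * pd i (fun x => cv (fun y => h y * Real.exp (-V y)) η x * Real.exp (V x)) x ^ 2
        * Real.exp (-V x)
      ≤ 2 * n * (Real.exp 1 * (5 * κ ^ 2 + 2 * τ ^ 2))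
        * ∫ y, h y ^ 2 * Real.exp (-V y) := by
  set H : Euc n → ℝ := fun y => h y * Real.exp (-V y) with hH
  set N := cv H η with hN
  set B := cv (fun y => h y ^ 2 * Real.exp (-V y)) η with hB
  set G : Euc n → ℝ := fun x => N x * Real.exp (V x) with hG
  set J : Fin n → Euc n → ℝ := fun i => cv (fun y => H y * pd i V y) η with hJ
  have h1' : LocallyIntegrable H := h1.locallyIntegrable
  have hHV : ∀ i, LocallyIntegrable (fun y => H y * pd i V y) := fun i =>
    locallyIntegrable_mul_continuous h1' (continuous_pd hV i)
  have hNs : ContDiff ℝ (⊤ : ℕ∞) N := contDiff_cv h1' hη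
  have hN1 : ContDiff ℝ 1 N := hNs.of_le (by exact_mod_cast le_top)
  have hJs : ∀ i, ContDiff ℝ 1 (J i) := fun i =>
    (contDiff_cv (hHV i) hη).of_le (by exact_mod_cast le_top)
  have hN2 : ContDiff ℝ 2 N := by exact_mod_cast contDiff_infty.1 hNs 2
  have hexp : ContDiff ℝ 1 (fun x => Real.exp (V x)) := hV.exp
  have hG1 : ContDiff ℝ 1 G := hN1.mul hexp
  set P : Fin n → Euc n → ℝ := fun i x => pd i N x + J i x with hP
  have hpN : ∀ i, ContDiff ℝ 1 (pd i N) := fun i =>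
    contDiff_pd hN2 (by norm_num) i
  have hP1 : ∀ i, ContDiff ℝ 1 (P i) := fun i => (hpN i).add (hJs i)
  set ψ : Euc n → ℝ := fun x => G x * (χ x * χ x) with hψ
  have hψ1 : ContDiff ℝ 1 ψ := hG1.mul (hχ.contDiff_one.mul hχ.contDiff_one)
  have hψc : HasCompactSupport ψ := (hχ.2.mul_right (f' := χ)).mul_left
  have hpP : ∀ i x, pd i (P i) x = cv H (pd i (pd i η)) x
      + cv (fun y => H y * pd i V y) (pd i η) x := by
    intro i x
    have e1 : pd i N = cv H (pd i η) := funext fun x => pd_cv h1' hη i x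
    rw [hP, pd_add ((hpN i).differentiable one_ne_zero x) ((hJs i).differentiable one_ne_zero x),
      pd_cv (hHV i) hη, e1, pd_cv h1' (hη.pd i)]
  have hzero : ∑ i, ∫ x, P i x * pd i ψ x = 0 := by
    simp_rw [fun i => integral_pd_mul (hP1 i) hψ1 (Or.inr hψc) i]
    rw [Finset.sum_neg_distrib, ← integral_finsetSum _ fun i _ =>
      integrable_mul_compact (continuous_pd (hP1 i) i) hψ1.continuous hψc]
    rw [neg_eq_zero]
    refine integral_eq_zero_of_ae (.of_forall fun x => ?_)
    simp only [← Finset.sum_mul, hpP]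
    rw [sum_cv_eq_zero hV h1' hL hη x]
    simp
  have hG' : ∀ i x, pd i G x = pd i N x * Real.exp (V x)
      + N x * (Real.exp (V x) * pd i V x) := fun i x => by
    rw [hG, pd_mul (hN1.differentiable one_ne_zero x) (hexp.differentiable one_ne_zero x),
      pd_comp (Real.hasDerivAt_exp _) (hV.differentiable one_ne_zero x)]
  have hχd : Differentiable ℝ χ := hχ.differentiable
  have hψ' : ∀ i x, pd i ψ x = 2 * χ x * pd i χ x * G x + χ x ^ 2 * pd i G x := fun i x => by
    rw [hψ, pd_mul (g := fun y => χ y * χ y) (hG1.differentiable one_ne_zero x)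
        ((hχd x).mul (hχd x)),
      pd_mul (hχd x) (hχd x)]
    ring
  have hB0 : ∀ x, 0 ≤ B x := fun x =>
    integral_nonneg fun y => mul_nonneg (by positivity) (hη0 _)
  have hBi : Integrable B := by
    rw [hB, cv_eq]
    exact h2.integrable_convolution _ (hη.continuous.integrable_of_hasCompactSupport hη.2)
  have hBint : ∫ x, B x = ∫ y, h y ^ 2 * Real.exp (-V y) := by
    rw [hB, cv_eq, integral_convolution _ h2
      (hη.continuous.integrable_of_hasCompactSupport hη.2), hη1]
    simp
  have hpt : ∀ i x, 1 / 2 * (χ x ^ 2 * pd i G x ^ 2 * Real.exp (-V x))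
      - Real.exp 1 * (5 * κ ^ 2 + 2 * τ ^ 2) * B x ≤ P i x * pd i ψ x := by
    intro i x
    rw [hψ']
    by_cases hx : x ∈ tsupport χ
    · have hρE : Real.exp (-V x) * Real.exp (V x) = 1 := by rw [← Real.exp_add]; simp
      have hPx : P i x = Real.exp (-V x) * pd i G x + (J i x - N x * pd i V x) := by
        rw [hG', hP]
        linear_combination (-(pd i N x) - N x * pd i V x) * hρE
      rw [hPx]
      refine energy_quadratic_bound (Real.exp_pos _) hρE (hχ1 x) (hχκ i x) (N := N x) rfl ?_ ?_
      · have := sq_cv_le (k := fun _ => 1) (ω := 1) hV.continuous continuous_const h1'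
          h2.locallyIntegrable hη hη0 hη1 (hVx x hx) (by simp)
        simpa using this
      · have := sq_cv_le (k := fun y => pd i V y - pd i V x) (ω := τ) hV.continuous
          ((continuous_pd hV i).sub continuous_const) h1'
          h2.locallyIntegrable hη hη0 hη1 (hVx x hx) (fun y hy => hVix x hx y hy i)
        have e : cv (fun y => h y * Real.exp (-V y) * (pd i V y - pd i V x)) η x
            = J i x - N x * pd i V x := by
          rw [hJ, hN]
          unfold cv
          rw [← integral_mul_const, ← integral_sub
            (integrable_cv_integrand (hHV i) hη.continuous hη.2 x)
            ((integrable_cv_integrand h1' hη.continuous hη.2 x).mul_const _)]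
          refine integral_congr_ae (.of_forall fun y => ?_)
          simp only [hH]; ring
        rwa [e] at this
    · have e0 : χ x = 0 := image_eq_zero_of_notMem_tsupport hx
      have := hB0 x
      simp only [e0]
      have : 0 ≤ Real.exp 1 * (5 * κ ^ 2 + 2 * τ ^ 2) * B x := by positivity
      simpa using this
  have hi1 : ∀ i, Integrable (fun x => χ x ^ 2 * pd i G x ^ 2 * Real.exp (-V x)) := fun i => by
    have hc : Continuous fun x => pd i G x ^ 2 * Real.exp (-V x) * χ x :=
      (((continuous_pd hG1 i).pow 2).mul (Real.continuous_exp.comp hV.continuous.neg)).mul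
        hχ.continuous
    refine (integrable_mul_compact hc hχ.continuous hχ.2).congr (.of_forall fun x => ?_)
    simp only; ring
  have hi2 : ∀ i, Integrable (fun x => P i x * pd i ψ x) := fun i =>
    integrable_mul_compact (hP1 i).continuous (continuous_pd hψ1 i) (hψc.pd i)
  have hint : ∀ i, 1 / 2 * (∫ x, χ x ^ 2 * pd i G x ^ 2 * Real.exp (-V x))
      - Real.exp 1 * (5 * κ ^ 2 + 2 * τ ^ 2) * ∫ y, h y ^ 2 * Real.exp (-V y)
      ≤ ∫ x, P i x * pd i ψ x := fun i => by
    rw [← hBint, ← integral_const_mul, ← integral_const_mul,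
      ← integral_sub ((hi1 i).const_mul _) (hBi.const_mul _)]
    exact integral_mono (((hi1 i).const_mul _).sub (hBi.const_mul _)) (hi2 i) (hpt i)
  have hsum := Finset.sum_le_sum fun i (_ : i ∈ Finset.univ) => hint i
  rw [hzero, Finset.sum_sub_distrib, ← Finset.mul_sum] at hsum
  simp only [Finset.sum_const, Finset.card_univ, Fintype.card_fin, nsmul_eq_mul] at hsum
  linarith

lemma exists_cutoff (R₀ : ℝ) {κ : ℝ} (hκ : 0 < κ) : ∃ χ : Euc n → ℝ, IsTest χ ∧
    (∀ x, |χ x| ≤ 1) ∧ (∀ x, ‖x‖ ≤ R₀ → χ x = 1) ∧ ∀ i x, |pd i χ x| ≤ κ := by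
  let f : ContDiffBump (0 : Euc n) := ⟨1, 2, one_pos, one_lt_two⟩
  have hf : IsTest (f : Euc n → ℝ) := ⟨f.contDiff, f.hasCompactSupport⟩
  obtain ⟨C, hC⟩ := (hf.contDiff_one.continuous_fderiv one_ne_zero).bounded_above_of_compact_support
    (hf.2.fderiv ℝ)
  have hC0 : 0 ≤ C := (norm_nonneg _).trans (hC 0)
  set R : ℝ := |R₀| + C / κ + 1 with hR
  have hRpos : 0 < R := by positivity
  refine ⟨fun x => f (R⁻¹ • x), ⟨f.contDiff.comp (contDiff_const_smul _), ?_⟩, ?_, ?_, ?_⟩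
  · exact hf.2.comp_homeomorph (Homeomorph.smulOfNeZero R⁻¹ (inv_ne_zero hRpos.ne'))
  · intro x
    rw [abs_of_nonneg f.nonneg]
    exact f.le_one
  · intro x hx
    refine f.one_of_mem_closedBall ?_
    rw [mem_closedBall_zero_iff, norm_smul, norm_inv, Real.norm_of_nonneg hRpos.le,
      inv_mul_le_iff₀ hRpos]
    have : 0 ≤ C / κ := by positivity
    change ‖x‖ ≤ R * 1
    linarith [le_abs_self R₀]
  · intro i x
    have h := ((hf.differentiable (R⁻¹ • x)).hasFDerivAt.comp x
      ((hasFDerivAt_id x).const_smul R⁻¹)).fderiv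
    have h' : pd i (fun x => f (R⁻¹ • x)) x = R⁻¹ * pd i f (R⁻¹ • x) := by
      have h'' : fderiv ℝ (fun x => f (R⁻¹ • x)) x
        = (fderiv ℝ f (R⁻¹ • x)).comp (R⁻¹ • ContinuousLinearMap.id ℝ (Euc n)) := h
      simp [pd, h'']
    rw [h', abs_mul, abs_of_pos (inv_pos.2 hRpos), inv_mul_le_iff₀ hRpos]
    have h2 : |pd i f (R⁻¹ • x)| ≤ C := by
      have := (fderiv ℝ f (R⁻¹ • x)).le_opNorm (EuclideanSpace.single i 1)
      rw [PiLp.norm_single, norm_one, mul_one] at this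
      exact this.trans (hC _)
    have h3 : C ≤ R * κ := by
      rw [hR]
      have : C / κ * κ = C := div_mul_cancel₀ _ hκ.ne'
      nlinarith [abs_nonneg R₀]
    exact h2.trans h3

lemma exists_mollifier {ε : ℝ} (hε : 0 < ε) : ∃ η : Euc n → ℝ, IsTest η ∧ (∀ y, 0 ≤ η y) ∧
    ∫ y, η y = 1 ∧ ∀ y, η y ≠ 0 → ‖y‖ < ε := by
  let f : ContDiffBump (0 : Euc n) := ⟨ε / 2, ε, by positivity, by linarith⟩
  refine ⟨f.normed volume, ⟨f.contDiff_normed, f.hasCompactSupport_normed⟩, f.nonneg_normed,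
    f.integral_normed, fun y hy => ?_⟩
  have : y ∈ Function.support (f.normed volume) := hy
  rw [f.support_normed_eq] at this
  simpa using this

lemma abs_integral_cv_mul_sub_le {H k η : Euc n → ℝ} (hH : Integrable H) (hk : Continuous k)
    (hkc : HasCompactSupport k) (hη : IsTest η) (hη0 : ∀ y, 0 ≤ η y) (hη1 : ∫ y, η y = 1) {τ : ℝ}
    (hτ : ∀ x y, η (x - y) ≠ 0 → |k x - k y| ≤ τ) :
    |(∫ x, cv H η x * k x) - ∫ x, H x * k x| ≤ τ * ∫ x, |H x| := by
  obtain ⟨C, hC⟩ := hk.bounded_above_of_compact_support hkc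
  have hηi : Integrable η := hη.continuous.integrable_of_hasCompactSupport hη.2
  have hprod : Integrable (fun p : Euc n × Euc n => H p.2 * η (p.1 - p.2) * k p.1)
      (volume.prod volume) :=
    (hH.convolution_integrand (ContinuousLinearMap.mul ℝ ℝ) hηi).mul_bdd (c := C)
      (hk.comp continuous_fst).aestronglyMeasurable (.of_forall fun p => hC _)
  have e1 : ∫ x, cv H η x * k x = ∫ y, H y * ∫ x, η (x - y) * k x := by
    unfold cv
    simp_rw [← integral_mul_const, ← integral_const_mul]
    rw [integral_integral_swap hprod]
    simp_rw [mul_assoc]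
  have i1 : ∀ y, Integrable (fun x => η (x - y)) := fun y => hηi.comp_sub_right y
  have i2 : ∀ y, Integrable (fun x => η (x - y) * k x) := fun y =>
    integrable_mul_compact (hη.continuous.comp (continuous_id.sub continuous_const)) hk hkc
  have e2 : ∀ y, ∫ x, η (x - y) = 1 := fun y => by
    rw [integral_sub_right_eq_self η y, hη1]
  have hin : ∀ y, |(∫ x, η (x - y) * k x) - k y| ≤ τ := by
    intro y
    have : (∫ x, η (x - y) * k x) - k y = ∫ x, η (x - y) * (k x - k y) := by
      simp_rw [mul_sub]
      rw [integral_sub (i2 y) ((i1 y).mul_const _), integral_mul_const, e2, one_mul]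
    rw [this]
    calc |∫ x, η (x - y) * (k x - k y)| ≤ ∫ x, η (x - y) * τ := by
          rw [← Real.norm_eq_abs]
          refine norm_integral_le_of_norm_le ((i1 y).mul_const _) (.of_forall fun x => ?_)
          rw [norm_mul, Real.norm_of_nonneg (hη0 _)]
          by_cases h : η (x - y) = 0
          · simp [h]
          · exact mul_le_mul_of_nonneg_left (hτ x y h) (hη0 _)
      _ = τ := by rw [integral_mul_const, e2, one_mul]
  have i3 : Integrable (fun y => H y * ∫ x, η (x - y) * k x) := by
    have := hprod.integral_prod_right
    refine this.congr (.of_forall fun y => ?_)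
    simp only [mul_assoc]
    rw [integral_const_mul]
  have i4 : Integrable (fun y => H y * k y) :=
    hH.mul_bdd (c := C) hk.aestronglyMeasurable (.of_forall hC)
  rw [e1, ← integral_sub i3 i4, ← Real.norm_eq_abs, ← integral_const_mul]
  refine norm_integral_le_of_norm_le (hH.abs.const_mul _) (.of_forall fun y => ?_)
  rw [← mul_sub, norm_mul, mul_comm, Real.norm_eq_abs, Real.norm_eq_abs]
  exact mul_le_mul_of_nonneg_right (hin y) (abs_nonneg _)

lemma integral_mul_pd_eq_zero {V h : Euc n → ℝ} (hV : ContDiff ℝ 1 V)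
    (h1 : Integrable (fun y => h y * Real.exp (-V y)))
    (h2 : Integrable (fun y => h y ^ 2 * Real.exp (-V y)))
    (hL : ∀ u, IsTest u → ∫ x, h x * genL V u x ∂(gibbs V) = 0)
    {ζ : Euc n → ℝ} (hζ : IsTest ζ) (i : Fin n) : ∫ x, h x * pd i ζ x = 0 := by
  set H : Euc n → ℝ := fun y => h y * Real.exp (-V y) with hH
  set M := ∫ y, h y ^ 2 * Real.exp (-V y)
  set Z := ∫ x, ζ x ^ 2 * Real.exp (V x)
  set k : Euc n → ℝ := fun x => Real.exp (V x) * pd i ζ x with hk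
  have hE : Continuous fun x => Real.exp (V x) := Real.continuous_exp.comp hV.continuous
  have hkc : Continuous k := hE.mul (hζ.pd i).continuous
  have hks : HasCompactSupport k := (hζ.pd i).2.mul_left
  have hA : ∫ x, h x * pd i ζ x = ∫ x, H x * k x := by
    refine integral_congr_ae (.of_forall fun x => ?_)
    have : Real.exp (-V x) * Real.exp (V x) = 1 := by rw [← Real.exp_add]; simp
    simp only [hH, hk]
    linear_combination (-(h x * pd i ζ x)) * this
  obtain ⟨R₀, hR₀⟩ := hζ.2.isCompact.isBounded.exists_norm_le
  have bound : ∀ τ : ℝ, 0 < τ → |∫ x, h x * pd i ζ x|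
      ≤ τ * ((∫ x, |H x|) + (n * (Real.exp 1 * 7) * M + Z / 2)) := by
    intro τ hτ
    obtain ⟨χ, hχ, hχ1, hχe, hχκ⟩ := exists_cutoff (n := n) R₀ hτ
    obtain ⟨R', hR'⟩ := hχ.2.isCompact.isBounded.exists_norm_le
    let Φ : Euc n → ℝ × (Fin n → ℝ) := fun x => (V x, fun i => pd i V x)
    have hΦ : Continuous Φ :=
      hV.continuous.prodMk (continuous_pi fun i => continuous_pd hV i)
    have hu := (isCompact_closedBall (0 : Euc n) (R' + 1)).uniformContinuousOn_of_continuous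
      hΦ.continuousOn
    obtain ⟨δ, hδ, hδΦ⟩ := Metric.uniformContinuousOn_iff.1 hu (min 1 τ) (by positivity)
    obtain ⟨δ', hδ', hδk⟩ := Metric.uniformContinuous_iff.1
      (hks.uniformContinuous_of_continuous hkc) τ hτ
    obtain ⟨η, hη, hη0, hη1, hηε⟩ := exists_mollifier (n := n)
      (ε := min (min δ δ') 1) (by positivity)
    have hclose : ∀ x ∈ tsupport χ, ∀ y, η (x - y) ≠ 0 → dist (Φ y) (Φ x) < min 1 τ := by
      intro x hx y hxy
      have h := hηε _ hxy
      have hx' := hR' x hx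
      refine hδΦ y ?_ x ?_ ?_
      · rw [mem_closedBall_zero_iff]
        have : ‖x - y‖ < 1 := h.trans_le (min_le_right _ _)
        have h3 : ‖y‖ ≤ ‖x‖ + ‖x - y‖ := by
          have := norm_sub_le x (x - y)
          simpa using this
        linarith
      · rw [mem_closedBall_zero_iff]; linarith
      · rw [dist_comm, dist_eq_norm]
        exact h.trans_le ((min_le_left _ _).trans (min_le_left _ _))
    have hen := energy_estimate hV h1 h2 hL hη hη0 hη1 hχ hχ1 hχκ (τ := τ)
      (fun x hx y hxy => by
        have := (le_max_left _ _).trans_lt (hclose x hx y hxy)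
        have h3 : |V y - V x| < min 1 τ := this
        have := (abs_lt.1 (h3.trans_le (min_le_left _ _))).1
        linarith)
      (fun x hx y hxy i => by
        have := (le_max_right _ _).trans_lt (hclose x hx y hxy)
        have h3 : dist (fun i => pd i V y) (fun i => pd i V x) < min 1 τ := this
        have h4 := (dist_le_pi_dist (fun i => pd i V y) (fun i => pd i V x) i).trans_lt h3
        exact (h4.trans_le (min_le_right _ _)).le)
    set N := cv H η with hN
    set G : Euc n → ℝ := fun x => N x * Real.exp (V x) with hG
    have hN1 : ContDiff ℝ 1 N :=
      (contDiff_cv h1.locallyIntegrable hη).of_le (by exact_mod_cast le_top)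
    have hG1 : ContDiff ℝ 1 G := hN1.mul hV.exp
    have hi : ∀ i, Integrable (fun x => χ x ^ 2 * pd i G x ^ 2 * Real.exp (-V x)) := fun i => by
      have hc : Continuous fun x => pd i G x ^ 2 * Real.exp (-V x) * χ x :=
        (((continuous_pd hG1 i).pow 2).mul (Real.continuous_exp.comp hV.continuous.neg)).mul
          hχ.continuous
      refine (integrable_mul_compact hc hχ.continuous hχ.2).congr (.of_forall fun x => ?_)
      simp only; ring
    have hZi : Integrable (fun x => ζ x ^ 2 * Real.exp (V x)) := by
      refine (integrable_mul_compact (hE.mul hζ.continuous) hζ.continuous hζ.2).congr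
        (.of_forall fun x => ?_)
      simp only [Pi.mul_apply]; ring
    have hD : |∫ x, N x * k x| ≤ 1 / (2 * τ) * (∫ x, χ x ^ 2 * pd i G x ^ 2 * Real.exp (-V x))
        + τ / 2 * Z := by
      have e : ∫ x, N x * k x = -∫ x, pd i G x * ζ x := by
        rw [← integral_pd_mul hG1 hζ.contDiff_one (Or.inr hζ.2) i]
        refine integral_congr_ae (.of_forall fun x => ?_)
        simp only [hG, hk]; ring
      rw [e, abs_neg, ← integral_const_mul, ← integral_const_mul,
        ← integral_add ((hi i).const_mul _) (hZi.const_mul _), ← Real.norm_eq_abs]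
      refine norm_integral_le_of_norm_le (((hi i).const_mul _).add (hZi.const_mul _))
        (.of_forall fun x => ?_)
      rw [Real.norm_eq_abs]
      by_cases hx : ζ x = 0
      · simp only [hx]
        have : 0 ≤ 1 / (2 * τ) * (χ x ^ 2 * pd i G x ^ 2 * Real.exp (-V x)) := by positivity
        simpa using this
      have hx1 : χ x = 1 := hχe x (hR₀ x (subset_tsupport _ hx))
      have hρE : Real.exp (-V x) * Real.exp (V x) = 1 := by rw [← Real.exp_add]; simp
      rw [hx1]
      set ρ := Real.exp (-V x)
      set E := Real.exp (V x)
      have hρ : 0 < ρ := Real.exp_pos _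
      have hE0 : 0 < E := Real.exp_pos _
      have key : ∀ s : ℝ, s ^ 2 = 1 → s * (pd i G x * ζ x)
          ≤ 1 / (2 * τ) * (1 ^ 2 * pd i G x ^ 2 * ρ) + τ / 2 * (ζ x ^ 2 * E) := by
        intro s hs
        have h0 : 0 ≤ ρ / (2 * τ) * (s * pd i G x - τ * ζ x * E) ^ 2 := by positivity
        have : ρ / (2 * τ) * (s * pd i G x - τ * ζ x * E) ^ 2
            = 1 / (2 * τ) * (1 ^ 2 * pd i G x ^ 2 * ρ) + τ / 2 * (ζ x ^ 2 * E)
              - s * (pd i G x * ζ x) := by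
          field_simp
          linear_combination (ρ * pd i G x ^ 2) * hs
            + (-2 * s * pd i G x * τ * ζ x + τ ^ 2 * ζ x ^ 2 * E) * hρE
        linarith
      rw [abs_le]
      constructor
      · have := key (-1) (by norm_num)
        linarith
      · have := key 1 (by norm_num)
        linarith
    have hDA := abs_integral_cv_mul_sub_le h1 hkc hks hη hη0 hη1 (τ := τ) fun x y hxy => by
      refine (hδk (a := x) (b := y) ?_).le
      rw [dist_eq_norm]
      exact (hηε _ hxy).trans_le ((min_le_left _ _).trans (min_le_right _ _))
    have hen_i : (∫ x, χ x ^ 2 * pd i G x ^ 2 * Real.exp (-V x))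
        ≤ 2 * n * (Real.exp 1 * (5 * τ ^ 2 + 2 * τ ^ 2)) * M :=
      (Finset.single_le_sum (f := fun i => ∫ x, χ x ^ 2 * pd i G x ^ 2 * Real.exp (-V x))
        (fun i _ => integral_nonneg fun x => by positivity) (Finset.mem_univ i)).trans hen
    have hfin : 1 / (2 * τ) * (∫ x, χ x ^ 2 * pd i G x ^ 2 * Real.exp (-V x))
        ≤ τ * (n * (Real.exp 1 * 7) * M) := by
      calc _ ≤ 1 / (2 * τ) * (2 * n * (Real.exp 1 * (5 * τ ^ 2 + 2 * τ ^ 2)) * M) := by gcongr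
        _ = _ := by field_simp; ring
    rw [hA]
    have h4 : |∫ x, H x * k x| ≤ |(∫ x, N x * k x) - ∫ x, H x * k x| + |∫ x, N x * k x| := by
      have := abs_sub_abs_le_abs_sub (∫ x, H x * k x) (∫ x, N x * k x)
      rw [abs_sub_comm] at this
      linarith
    nlinarith
  by_contra hne
  set a := |∫ x, h x * pd i ζ x| with ha
  have hapos : 0 < a := abs_pos.2 hne
  set C := (∫ x, |H x|) + (n * (Real.exp 1 * 7) * M + Z / 2) with hC
  have hC0 : 0 ≤ C := by
    have h5 : 0 ≤ ∫ x, |H x| := integral_nonneg fun x => abs_nonneg _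
    have h6 : 0 ≤ M := integral_nonneg fun x => by positivity
    have h7 : 0 ≤ Z := integral_nonneg fun x => by positivity
    positivity
  have := bound (a / (2 * (C + 1))) (by positivity)
  have h8 : a / (2 * (C + 1)) * C < a := by
    rw [div_mul_eq_mul_div, div_lt_iff₀ (by positivity)]
    nlinarith
  linarith

/-- A locally integrable function with vanishing weak gradient is almost everywhere constant. -/
lemma ae_eq_const_of_integral_mul_pd_eq_zero {h : Euc n → ℝ} (hh : LocallyIntegrable h)
    (h0 : ∀ ζ, IsTest ζ → ∀ i, ∫ x, h x * pd i ζ x = 0) : ∃ c : ℝ, ∀ᵐ x, h x = c := by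
  let φ : ℕ → ContDiffBump (0 : Euc n) := fun k =>
    ⟨1 / (k + 1), 2 * (1 / (k + 1)), by positivity, by
      have : (0 : ℝ) < 1 / (k + 1) := by positivity
      linarith⟩
  have hφ : Filter.Tendsto (fun k => (φ k).rOut) Filter.atTop (nhds 0) := by
    have := (tendsto_one_div_add_atTop_nhds_zero_nat (𝕜 := ℝ)).const_mul 2
    simpa [φ] using this
  have hae := ContDiffBump.ae_convolution_tendsto_right_of_locallyIntegrable (μ := volume)
    (K := 2) hφ (.of_forall fun k => le_rfl) hh
  have hconst : ∀ k x, (convolution ((φ k).normed volume) h (ContinuousLinearMap.lsmul ℝ ℝ)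
      volume) x = (convolution ((φ k).normed volume) h (ContinuousLinearMap.lsmul ℝ ℝ)
      volume) 0 := by
    intro k x
    have hη : IsTest ((φ k).normed volume) :=
      ⟨(φ k).contDiff_normed, (φ k).hasCompactSupport_normed⟩
    have e : ∀ x, (convolution ((φ k).normed volume) h (ContinuousLinearMap.lsmul ℝ ℝ)
        volume) x = cv h ((φ k).normed volume) x := fun x => by
      rw [convolution_lsmul_swap]
      simp [cv, mul_comm]
    rw [e, e]
    refine is_const_of_fderiv_eq_zero (𝕜 := ℝ) ((contDiff_cv hh hη).differentiable (by simp)) ?_ x 0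
    intro x
    have hp : ∀ i, pd i (cv h ((φ k).normed volume)) x = 0 := by
      intro i
      rw [pd_cv hh hη]
      have := h0 _ (hη.sub_left x) i
      simp_rw [pd_sub_left hη.differentiable, mul_neg, integral_neg] at this
      simpa [cv] using this
    ext1 v
    have hv : v = ∑ i, v i • EuclideanSpace.single i (1 : ℝ) := by
      have := (EuclideanSpace.basisFun (Fin n) ℝ).sum_repr v
      simpa using this.symm
    rw [hv, map_sum]
    simp only [map_smul]
    exact Finset.sum_eq_zero fun i _ => by
      have := hp i
      unfold pd at this
      rw [this]; simp
  obtain ⟨x₀, hx₀⟩ := hae.exists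
  refine ⟨h x₀, ?_⟩
  filter_upwards [hae] with x hx
  refine tendsto_nhds_unique hx ?_
  simp_rw [hconst _ x]
  simp_rw [hconst _ x₀] at hx₀
  exact hx₀

lemma continuous_genL {V u : Euc n → ℝ} (hV : ContDiff ℝ 1 V) (hu : IsTest u) :
    Continuous (genL V u) :=
  continuous_finsetSum _ fun i _ =>
    ((hu.pd i).pd i).continuous.sub ((continuous_pd hV i).mul (hu.pd i).continuous)

lemma hasCompactSupport_genL (V : Euc n → ℝ) {u : Euc n → ℝ} (hu : IsTest u) :
    HasCompactSupport (genL V u) := by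
  refine hu.2.mono' fun x hx => ?_
  by_contra hxu
  refine hx (Finset.sum_eq_zero fun i _ => ?_)
  have h1 : pd i u x = 0 := image_eq_zero_of_notMem_tsupport fun h =>
    hxu (tsupport_fderiv_apply_subset ℝ _ h)
  have h2 : pd i (pd i u) x = 0 := image_eq_zero_of_notMem_tsupport fun h =>
    hxu (tsupport_fderiv_apply_subset ℝ _ (tsupport_fderiv_apply_subset ℝ _ h))
  rw [h1, h2]; simp

lemma genL_add (V : Euc n → ℝ) {u w : Euc n → ℝ} (hu : IsTest u) (hw : IsTest w) (x : Euc n) :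
    genL V (fun y => u y + w y) x = genL V u x + genL V w x := by
  have h1 : ∀ i, pd i (fun y => u y + w y) = fun y => pd i u y + pd i w y := fun i => by
    ext y; exact pd_add (hu.differentiable y) (hw.differentiable y) i
  unfold genL
  rw [← Finset.sum_add_distrib]
  refine Finset.sum_congr rfl fun i _ => ?_
  rw [h1, pd_add ((hu.pd i).differentiable x) ((hw.pd i).differentiable x)]
  ring

lemma genL_const_mul (V : Euc n → ℝ) {u : Euc n → ℝ} (hu : IsTest u) (c : ℝ) (x : Euc n) :
    genL V (fun y => c * u y) x = c * genL V u x := by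
  have h1 : ∀ i, pd i (fun y => c * u y) = fun y => c * pd i u y := fun i => by
    ext y; exact pd_const_mul (hu.differentiable y) c i
  unfold genL
  rw [Finset.mul_sum]
  refine Finset.sum_congr rfl fun i _ => ?_
  rw [h1, pd_const_mul ((hu.pd i).differentiable x)]
  ring

lemma IsTest.add {u w : Euc n → ℝ} (hu : IsTest u) (hw : IsTest w) :
    IsTest (fun y => u y + w y) :=
  ⟨hu.1.add hw.1, hu.2.add hw.2⟩

lemma IsTest.const_mul {u : Euc n → ℝ} (hu : IsTest u) (c : ℝ) :
    IsTest (fun y => c * u y) :=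
  ⟨contDiff_const.mul hu.1, hu.2.mul_left⟩

lemma IsTest.comp_neg {u : Euc n → ℝ} (hu : IsTest u) : IsTest (fun y => u (-y)) := by
  simpa using hu.sub_left 0

lemma isTest_zero : IsTest (fun _ : Euc n => (0 : ℝ)) :=
  ⟨contDiff_const, HasCompactSupport.zero⟩

lemma integral_mul_pd_gibbs {V f w : Euc n → ℝ} (hV : ContDiff ℝ 1 V) (hf : ContDiff ℝ 1 f)
    (hw : ContDiff ℝ 1 w) (hc : HasCompactSupport f ∨ HasCompactSupport w) (i : Fin n) :
    ∫ x, f x * (pd i w x - pd i V x * w x) ∂(gibbs V) = -∫ x, pd i f x * w x ∂(gibbs V) := by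
  rw [integral_gibbs hV.continuous, integral_gibbs hV.continuous]
  have hE : ContDiff ℝ 1 fun x => Real.exp (-V x) := hV.neg.exp
  have h := integral_pd_mul hf (hw.mul hE) (hc.imp_right fun h => h.mul_right) i
  have e : ∀ x, pd i (fun y => w y * Real.exp (-V y)) x
      = (pd i w x - pd i V x * w x) * Real.exp (-V x) := fun x => by
    have hVd := hV.differentiable one_ne_zero x
    rw [pd_mul (hw.differentiable one_ne_zero x) (hE.differentiable one_ne_zero x),
      pd_comp (f := V) (φ := fun t => Real.exp (-t)) (φ' := -Real.exp (-V x)) ?_ hVd]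
    · ring
    · simpa using (hasDerivAt_id (V x)).neg.exp
  simp_rw [e] at h
  simp_rw [mul_assoc] at h ⊢
  exact h

lemma integral_mul_genL {V f u : Euc n → ℝ} [IsFiniteMeasure (gibbs V)] (hV : ContDiff ℝ 1 V)
    (hf : ContDiff ℝ 1 f) (hu : IsTest u) :
    ∫ x, f x * genL V u x ∂(gibbs V) = -∑ i, ∫ x, pd i f x * pd i u x ∂(gibbs V) := by
  have hi : ∀ i, Integrable (fun x => f x * (pd i (pd i u) x - pd i V x * pd i u x))
      (gibbs V) := fun i => by
    refine (hf.continuous.mul (((hu.pd i).pd i).continuous.sub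
      ((continuous_pd hV i).mul (hu.pd i).continuous))).integrable_of_hasCompactSupport ?_
    exact HasCompactSupport.mul_left (((hu.pd i).pd i).2.sub ((hu.pd i).2.mul_left))
  simp_rw [genL, Finset.mul_sum]
  rw [integral_finsetSum _ fun i _ => hi i, ← Finset.sum_neg_distrib]
  exact Finset.sum_congr rfl fun i _ =>
    integral_mul_pd_gibbs hV hf (hu.pd i).contDiff_one (Or.inr (hu.pd i).2) i

lemma integral_genL {V u : Euc n → ℝ} [IsFiniteMeasure (gibbs V)] (hV : ContDiff ℝ 1 V)
    (hu : IsTest u) : ∫ x, genL V u x ∂(gibbs V) = 0 := by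
  have := integral_mul_genL hV (f := fun _ => 1) contDiff_const hu
  simpa [pd] using this

/-- Liouville property: a square-integrable `h` orthogonal to the range of the generator is
almost everywhere constant. -/
lemma ae_eq_const_of_integral_mul_genL {V h : Euc n → ℝ} [IsFiniteMeasure (gibbs V)]
    (hV : ContDiff ℝ 1 V) (hh : MemLp h 2 (gibbs V))
    (hL : ∀ u, IsTest u → ∫ x, h x * genL V u x ∂(gibbs V) = 0) :
    ∃ c : ℝ, ∀ᵐ x ∂(gibbs V), h x = c := by
  have h1 := (integrable_gibbs hV.continuous).1 (hh.integrable one_le_two)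
  have h2 := (integrable_gibbs hV.continuous).1 hh.integrable_sq
  have hloc : LocallyIntegrable h := by
    have hE : Continuous fun x => Real.exp (V x) := Real.continuous_exp.comp hV.continuous
    have := locallyIntegrable_mul_continuous h1.locallyIntegrable hE
    convert this using 2 with x
    rw [mul_assoc, ← Real.exp_add]; simp
  obtain ⟨c, hc⟩ := ae_eq_const_of_integral_mul_pd_eq_zero hloc fun ζ hζ i =>
    integral_mul_pd_eq_zero hV h1 h2 hL hζ i
  exact ⟨c, (ae_gibbs hV.continuous).2 hc⟩

/-- The space of functions `Lu + c` in `L²`. -/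
def genLSpace (V : Euc n → ℝ) (μ : Measure (Euc n)) : Submodule ℝ (Lp ℝ 2 μ) where
  carrier := {f | ∃ u c, IsTest u ∧ f =ᵐ[μ] fun x => genL V u x + c}
  zero_mem' := ⟨fun _ => 0, 0, isTest_zero, by
    filter_upwards [Lp.coeFn_zero ℝ 2 μ] with x hx
    have : (fun _ : Euc n => (0 : ℝ)) = fun y => 0 * (fun _ : Euc n => (0 : ℝ)) y := by simp
    rw [hx, this, genL_const_mul V isTest_zero]; simp⟩
  add_mem' := by
    rintro f g ⟨u, c, hu, hf⟩ ⟨w, d, hw, hg⟩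
    refine ⟨fun y => u y + w y, c + d, hu.add hw, ?_⟩
    filter_upwards [hf, hg, Lp.coeFn_add f g] with x h1 h2 h3
    rw [h3, Pi.add_apply, h1, h2, genL_add V hu hw]; ring
  smul_mem' := by
    rintro a f ⟨u, c, hu, hf⟩
    refine ⟨fun y => a * u y, a * c, hu.const_mul a, ?_⟩
    filter_upwards [hf, Lp.coeFn_smul a f] with x h1 h3
    rw [h3, Pi.smul_apply, h1, genL_const_mul V hu, smul_eq_mul]; ring

lemma memLp_genL {V u : Euc n → ℝ} [IsFiniteMeasure (gibbs V)] (hV : ContDiff ℝ 1 V)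
    (hu : IsTest u) (c : ℝ) : MemLp (fun x => genL V u x + c) 2 (gibbs V) :=
  ((continuous_genL hV hu).memLp_of_hasCompactSupport (hasCompactSupport_genL V hu)).add
    (memLp_const c)

lemma topologicalClosure_genLSpace {V : Euc n → ℝ} [IsFiniteMeasure (gibbs V)]
    (hV : ContDiff ℝ 1 V) : (genLSpace V (gibbs V)).topologicalClosure = ⊤ := by
  rw [Submodule.topologicalClosure_eq_top_iff, Submodule.eq_bot_iff]
  intro h hh
  rw [Submodule.mem_orthogonal'] at hh
  have key : ∀ u c, IsTest u → ∫ x, h x * (genL V u x + c) ∂(gibbs V) = 0 := by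
    intro u c hu
    have h2 := hh ((memLp_genL hV hu c).toLp _) ⟨u, c, hu, MemLp.coeFn_toLp _⟩
    rw [L2.inner_def] at h2
    rw [← h2]
    refine integral_congr_ae ?_
    filter_upwards [MemLp.coeFn_toLp (memLp_genL hV hu c)] with x hx
    rw [hx]
    simp [mul_comm]
  have hz : ∀ x, genL V (fun _ => 0) x = 0 := fun x => by
    have : (fun _ : Euc n => (0 : ℝ)) = fun y => 0 * (fun _ : Euc n => (0 : ℝ)) y := by simp
    rw [this, genL_const_mul V isTest_zero]; simp
  obtain ⟨c, hc⟩ := ae_eq_const_of_integral_mul_genL hV (Lp.memLp h) fun u hu => by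
    simpa using key u 0 hu
  have h0 := key _ c isTest_zero
  have h1 : ∫ x, h x * h x ∂(gibbs V) = 0 := by
    rw [← h0]
    refine integral_congr_ae ?_
    filter_upwards [hc] with x hx
    rw [hx, hz, zero_add]
  have h3 : ⟪h, h⟫ = (0 : ℝ) := by
    rw [L2.inner_def, ← h1]
    simp [pow_two]
  exact inner_self_eq_zero.1 h3

/-- Duality bound for the variance in terms of the generator. -/
lemma integral_sq_le_of_forall_genL {V g : Euc n → ℝ} [IsFiniteMeasure (gibbs V)]
    (hV : ContDiff ℝ 1 V) (hg : MemLp g 2 (gibbs V)) (hg0 : ∫ x, g x ∂(gibbs V) = 0) {C : ℝ}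
    (hC : ∀ u, IsTest u →
      2 * (∫ x, g x * genL V u x ∂(gibbs V)) - ∫ x, genL V u x ^ 2 ∂(gibbs V) ≤ C) :
    ∫ x, g x ^ 2 ∂(gibbs V) ≤ C := by
  refine le_of_forall_pos_le_add fun ε hε => ?_
  have hmem : hg.toLp g ∈ closure (genLSpace V (gibbs V) : Set (Lp ℝ 2 (gibbs V))) := by
    rw [← Submodule.topologicalClosure_coe, topologicalClosure_genLSpace hV]; trivial
  obtain ⟨f, ⟨u, c, hu, hf⟩, hd⟩ := Metric.mem_closure_iff.1 hmem (Real.sqrt ε) (by positivity)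
  have hd2 : ‖hg.toLp g - f‖ ^ 2 ≤ ε := by
    rw [dist_eq_norm] at hd
    calc _ ≤ Real.sqrt ε ^ 2 := by gcongr
      _ = ε := Real.sq_sqrt hε.le
  have e1 : ‖hg.toLp g - f‖ ^ 2 = ∫ x, (g x - (genL V u x + c)) ^ 2 ∂(gibbs V) := by
    rw [← real_inner_self_eq_norm_sq, L2.inner_def]
    refine integral_congr_ae ?_
    filter_upwards [hf, hg.coeFn_toLp, Lp.coeFn_sub (hg.toLp g) f] with x h1 h2 h3
    rw [h3, Pi.sub_apply, h1, h2]
    simp [pow_two]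
  have mL : MemLp (genL V u) 2 (gibbs V) := by simpa using memLp_genL hV hu 0
  have iL : Integrable (genL V u) (gibbs V) := mL.integrable one_le_two
  have ig := hg.integrable one_le_two
  have i1 : Integrable (fun x => g x ^ 2) (gibbs V) := hg.integrable_sq
  have i2 : Integrable (fun x => genL V u x ^ 2) (gibbs V) := mL.integrable_sq
  have i3 : Integrable (fun x => g x * genL V u x) (gibbs V) := hg.integrable_mul mL
  have e2 : ∫ x, (g x - (genL V u x + c)) ^ 2 ∂(gibbs V)
      = (∫ x, g x ^ 2 ∂(gibbs V)) - 2 * (∫ x, g x * genL V u x ∂(gibbs V))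
        + (∫ x, genL V u x ^ 2 ∂(gibbs V)) - 2 * c * (∫ x, g x ∂(gibbs V))
        + 2 * c * (∫ x, genL V u x ∂(gibbs V)) + ∫ _, c ^ 2 ∂(gibbs V) := by
    have j1 : Integrable (fun x => g x ^ 2 - 2 * (g x * genL V u x)) (gibbs V) :=
      i1.sub (i3.const_mul 2)
    have j2 : Integrable (fun x => g x ^ 2 - 2 * (g x * genL V u x) + genL V u x ^ 2)
      (gibbs V) := j1.add i2
    have j3 : Integrable (fun x => g x ^ 2 - 2 * (g x * genL V u x) + genL V u x ^ 2
      - 2 * c * g x) (gibbs V) := j2.sub (ig.const_mul _)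
    have j4 : Integrable (fun x => g x ^ 2 - 2 * (g x * genL V u x) + genL V u x ^ 2
      - 2 * c * g x + 2 * c * genL V u x) (gibbs V) := j3.add (iL.const_mul _)
    rw [← integral_const_mul, ← integral_const_mul, ← integral_const_mul,
      ← integral_sub i1 (i3.const_mul 2), ← integral_add j1 i2, ← integral_sub j2 (ig.const_mul _),
      ← integral_add j3 (iL.const_mul _), ← integral_add j4 (integrable_const _)]
    refine integral_congr_ae (.of_forall fun x => ?_)
    simp only; ring
  rw [hg0, integral_genL hV hu] at e2
  have h5 : 0 ≤ ∫ _, c ^ 2 ∂(gibbs V) := integral_nonneg fun _ => sq_nonneg c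
  have := hC u hu
  linarith

lemma integral_comp_neg_gibbs {V : Euc n → ℝ} (hV : Continuous V) (hVe : ∀ x, V (-x) = V x)
    (f : Euc n → ℝ) : ∫ x, f (-x) ∂(gibbs V) = ∫ x, f x ∂(gibbs V) := by
  rw [integral_gibbs hV, integral_gibbs hV, ← integral_neg_eq_self]
  simp [hVe]

lemma integrable_comp_neg_gibbs {V : Euc n → ℝ} (hV : Continuous V) (hVe : ∀ x, V (-x) = V x)
    {f : Euc n → ℝ} (hf : Integrable f (gibbs V)) : Integrable (fun x => f (-x)) (gibbs V) := by
  rw [integrable_gibbs hV] at hf ⊢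
  simpa [hVe] using hf.comp_neg

lemma pd_neg_of_even {f : Euc n → ℝ} (hf : Differentiable ℝ f) (he : ∀ x, f (-x) = f x)
    (i : Fin n) (x : Euc n) : pd i f (-x) = -pd i f x := by
  have h := pd_neg_arg hf x i
  simp_rw [he] at h
  linarith

lemma genL_comp_neg {V u : Euc n → ℝ} (hV : Differentiable ℝ V) (hVe : ∀ x, V (-x) = V x)
    (hu : IsTest u) (x : Euc n) : genL V (fun y => u (-y)) x = genL V u (-x) := by
  have h1 : ∀ i, pd i (fun y => u (-y)) = fun y => (-1) * pd i u (-y) := fun i => by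
    ext y; rw [pd_neg_arg hu.differentiable]; ring
  unfold genL
  refine Finset.sum_congr rfl fun i _ => ?_
  rw [h1, pd_const_mul ((hu.pd i).comp_neg.differentiable x), pd_neg_arg (hu.pd i).differentiable,
    pd_neg_of_even hV hVe]
  ring

/-- For even data it suffices to test against even functions. -/
lemma integral_sq_le_of_forall_even_genL {V g : Euc n → ℝ} [IsFiniteMeasure (gibbs V)]
    (hV : ContDiff ℝ 1 V) (hVe : ∀ x, V (-x) = V x) (hg : MemLp g 2 (gibbs V))
    (hge : ∀ x, g (-x) = g x) (hg0 : ∫ x, g x ∂(gibbs V) = 0) {C : ℝ}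
    (hC : ∀ u, IsTest u → (∀ x, u (-x) = u x) →
      2 * (∫ x, g x * genL V u x ∂(gibbs V)) - ∫ x, genL V u x ^ 2 ∂(gibbs V) ≤ C) :
    ∫ x, g x ^ 2 ∂(gibbs V) ≤ C := by
  refine integral_sq_le_of_forall_genL hV hg hg0 fun u hu => ?_
  have hs := (hu.add hu.comp_neg).const_mul (1 / 2)
  have h := hC _ hs fun x => by simp [add_comm]
  have e : ∀ x, genL V (fun y => 1 / 2 * (u y + u (-y))) x
      = 1 / 2 * (genL V u x + genL V u (-x)) := fun x => by
    rw [genL_const_mul V (hu.add hu.comp_neg), genL_add V hu hu.comp_neg,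
      genL_comp_neg (hV.differentiable one_ne_zero) hVe hu]
  have mL : MemLp (genL V u) 2 (gibbs V) := by simpa using memLp_genL hV hu 0
  have mS : MemLp (genL V (fun y => 1 / 2 * (u y + u (-y)))) 2 (gibbs V) := by
    simpa using memLp_genL hV hs 0
  have i2 : Integrable (fun x => genL V u x ^ 2) (gibbs V) := mL.integrable_sq
  have i2' : Integrable (fun x => genL V u (-x) ^ 2) (gibbs V) :=
    integrable_comp_neg_gibbs (f := fun x => genL V u x ^ 2) hV.continuous hVe i2
  have i3 : Integrable (fun x => g x * genL V u x) (gibbs V) := hg.integrable_mul mL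
  have i3' : Integrable (fun x => g (-x) * genL V u (-x)) (gibbs V) :=
    integrable_comp_neg_gibbs (f := fun x => g x * genL V u x) hV.continuous hVe i3
  have e1 : ∫ x, g x * genL V (fun y => 1 / 2 * (u y + u (-y))) x ∂(gibbs V)
      = ∫ x, g x * genL V u x ∂(gibbs V) := by
    have : ∫ x, g x * genL V (fun y => 1 / 2 * (u y + u (-y))) x ∂(gibbs V)
        = 1 / 2 * ((∫ x, g x * genL V u x ∂(gibbs V))
          + ∫ x, g (-x) * genL V u (-x) ∂(gibbs V)) := by
      rw [← integral_add i3 i3', ← integral_const_mul]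
      refine integral_congr_ae (.of_forall fun x => ?_)
      simp only [e, hge]; ring
    rw [this, integral_comp_neg_gibbs hV.continuous hVe fun x => g x * genL V u x]
    ring
  have e2 : ∫ x, genL V (fun y => 1 / 2 * (u y + u (-y))) x ^ 2 ∂(gibbs V)
      ≤ ∫ x, genL V u x ^ 2 ∂(gibbs V) := by
    calc _ ≤ ∫ x, 1 / 2 * (genL V u x ^ 2 + genL V u (-x) ^ 2) ∂(gibbs V) := by
          refine integral_mono mS.integrable_sq ((i2.add i2').const_mul _) fun x => ?_
          simp only [e]
          nlinarith [sq_nonneg (genL V u x - genL V u (-x))]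
      _ = _ := by
          rw [integral_const_mul, integral_add i2 i2',
            integral_comp_neg_gibbs hV.continuous hVe fun x => genL V u x ^ 2]
          ring
  rw [e1] at h
  linarith

lemma IsTest.mul {u w : Euc n → ℝ} (hu : IsTest u) (hw : IsTest w) :
    IsTest (fun y => u y * w y) :=
  ⟨hu.1.mul hw.1, hu.2.mul_right⟩

lemma isTest_sum {ι : Type*} {s : Finset ι} {u : ι → Euc n → ℝ} (hu : ∀ i, IsTest (u i)) :
    IsTest (fun y => ∑ i ∈ s, u i y) := by
  classical
  induction s using Finset.induction_on with
  | empty => simpa using isTest_zero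
  | insert a s ha ih => simpa [Finset.sum_insert ha] using (hu a).add ih

lemma IsTest.integrable_mul {μ : Measure (Euc n)} [IsFiniteMeasure μ] {u a : Euc n → ℝ}
    (hu : IsTest u) (ha : Continuous a) : Integrable (fun x => a x * u x) μ :=
  (ha.mul hu.continuous).integrable_of_hasCompactSupport hu.2.mul_left

lemma IsTest.integrable {μ : Measure (Euc n)} [IsFiniteMeasure μ] {u : Euc n → ℝ}
    (hu : IsTest u) : Integrable u μ :=
  hu.continuous.integrable_of_hasCompactSupport hu.2

lemma integral_mul_genL_eq {V f u : Euc n → ℝ} [IsFiniteMeasure (gibbs V)]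
    (hV : ContDiff ℝ 1 V) (hf : ContDiff ℝ 1 f) (hu : IsTest u) :
    ∫ x, f x * genL V u x ∂(gibbs V) = -∫ x, ∑ i, pd i f x * pd i u x ∂(gibbs V) := by
  rw [integral_mul_genL hV hf hu,
    integral_finsetSum _ fun i _ => (hu.pd i).integrable_mul (continuous_pd hf i)]

lemma contDiff_genL {V u : Euc n → ℝ} (hV : ContDiff ℝ 2 V) (hu : IsTest u) :
    ContDiff ℝ 1 (genL V u) :=
  ContDiff.sum fun i _ => ((hu.pd i).pd i).contDiff_one.sub
    ((contDiff_pd hV (by norm_num) i).mul (hu.pd i).contDiff_one)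

lemma pd_genL {V u : Euc n → ℝ} (hV : ContDiff ℝ 2 V) (hu : IsTest u) (i : Fin n) (x : Euc n) :
    pd i (genL V u) x = genL V (pd i u) x - ∑ j, pd i (pd j V) x * pd j u x := by
  have hVj : ∀ j, ContDiff ℝ 1 (pd j V) := fun j => contDiff_pd hV (by norm_num) j
  have hd : ∀ j, DifferentiableAt ℝ (fun y => pd j V y * pd j u y) x := fun j =>
    ((hVj j).differentiable one_ne_zero x).mul ((hu.pd j).differentiable x)
  have e1 : pd i (genL V u) x
      = ∑ j, pd i (fun y => pd j (pd j u) y - pd j V y * pd j u y) x := by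
    unfold genL
    exact pd_sum (fun j _ => (((hu.pd j).pd j).differentiable x).sub (hd j)) i
  have hc : ∀ j, pd i (pd j u) = pd j (pd i u) := fun j => by
    ext y; exact pd_comm (hu.contDiff 2) i j y
  rw [e1, genL, ← Finset.sum_sub_distrib]
  refine Finset.sum_congr rfl fun j _ => ?_
  rw [pd_sub (((hu.pd j).pd j).differentiable x) (hd j),
    pd_mul ((hVj j).differentiable one_ne_zero x) ((hu.pd j).differentiable x),
    pd_comm ((hu.pd j).contDiff 2), hc]
  ring

/-- Bochner's formula, integrated. -/
lemma integral_genL_sq {V u : Euc n → ℝ} [IsFiniteMeasure (gibbs V)] (hV : ContDiff ℝ 2 V)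
    (hu : IsTest u) :
    ∫ x, genL V u x ^ 2 ∂(gibbs V) = ∫ x, (∑ i, ∑ j, pd j (pd i u) x ^ 2
      + ∑ i, ∑ j, pd i (pd j V) x * pd i u x * pd j u x) ∂(gibbs V) := by
  have hV1 : ContDiff ℝ 1 V := hV.of_le (by norm_num)
  have hVij : ∀ i j, Continuous (pd i (pd j V)) := fun i j =>
    continuous_pd (contDiff_pd hV (by norm_num) j) i
  have i1 : ∀ i j, Integrable (fun x => pd j (pd i u) x ^ 2) (gibbs V) := fun i j => by
    simpa [pow_two] using ((hu.pd i).pd j).integrable_mul ((hu.pd i).pd j).continuous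
  have i2 : ∀ i j, Integrable (fun x => pd i (pd j V) x * pd i u x * pd j u x) (gibbs V) :=
    fun i j => (hu.pd j).integrable_mul ((hVij i j).mul (hu.pd i).continuous)
  have i3 : ∀ i, Integrable (fun x => pd i u x * genL V (pd i u) x) (gibbs V) := fun i => by
    simpa [mul_comm] using (hu.pd i).integrable_mul (continuous_genL hV1 (hu.pd i))
  have i4 : ∀ i, Integrable (fun x => ∑ j, pd i (pd j V) x * pd i u x * pd j u x) (gibbs V) :=
    fun i => integrable_finsetSum _ fun j _ => i2 i j
  have i5 : ∀ i, Integrable (fun x => ∑ j, pd j (pd i u) x ^ 2) (gibbs V) :=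
    fun i => integrable_finsetSum _ fun j _ => i1 i j
  have i6 : ∀ i, Integrable (fun x => pd i u x * genL V (pd i u) x
      - ∑ j, pd i (pd j V) x * pd i u x * pd j u x) (gibbs V) := fun i => (i3 i).sub (i4 i)
  have e0 : ∫ x, genL V u x ^ 2 ∂(gibbs V) = -∫ x, ∑ i, (pd i u x * genL V (pd i u) x
      - ∑ j, pd i (pd j V) x * pd i u x * pd j u x) ∂(gibbs V) := by
    have := integral_mul_genL_eq hV1 (contDiff_genL hV hu) hu
    simp_rw [← pow_two] at this
    rw [this]
    congr 1
    refine integral_congr_ae (.of_forall fun x => ?_)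
    refine Finset.sum_congr rfl fun i _ => ?_
    rw [pd_genL hV hu, sub_mul, Finset.sum_mul, mul_comm]
    congr 1
    exact Finset.sum_congr rfl fun j _ => by ring
  rw [e0, integral_finsetSum _ fun i _ => i6 i,
    integral_add (integrable_finsetSum _ fun i _ => i5 i) (integrable_finsetSum _ fun i _ => i4 i),
    integral_finsetSum _ fun i _ => i5 i, integral_finsetSum _ fun i _ => i4 i,
    ← Finset.sum_neg_distrib, ← Finset.sum_add_distrib]
  refine Finset.sum_congr rfl fun i _ => ?_
  rw [integral_sub (i3 i) (i4 i), integral_mul_genL_eq hV1 (hu.pd i).contDiff_one (hu.pd i)]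
  simp_rw [← pow_two]
  ring

lemma integral_comb_genL {V f u : Euc n → ℝ} [IsFiniteMeasure (gibbs V)] (hV : ContDiff ℝ 2 V)
    (hf : ContDiff ℝ 1 f) (hu : IsTest u) :
    2 * (∫ x, f x * genL V u x ∂(gibbs V)) - ∫ x, genL V u x ^ 2 ∂(gibbs V)
      = ∫ x, (-(2 * ∑ i, pd i f x * pd i u x) - ∑ i, ∑ j, pd j (pd i u) x ^ 2
        - ∑ i, ∑ j, pd i (pd j V) x * pd i u x * pd j u x) ∂(gibbs V) := by
  have hV1 : ContDiff ℝ 1 V := hV.of_le (by norm_num)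
  have hVij : ∀ i j, Continuous (pd i (pd j V)) := fun i j =>
    continuous_pd (contDiff_pd hV (by norm_num) j) i
  have i1 : Integrable (fun x => ∑ i, ∑ j, pd j (pd i u) x ^ 2) (gibbs V) :=
    integrable_finsetSum _ fun i _ => integrable_finsetSum _ fun j _ => by
      simpa [pow_two] using ((hu.pd i).pd j).integrable_mul ((hu.pd i).pd j).continuous
  have i2 : Integrable (fun x => ∑ i, ∑ j, pd i (pd j V) x * pd i u x * pd j u x) (gibbs V) :=
    integrable_finsetSum _ fun i _ => integrable_finsetSum _ fun j _ =>
      (hu.pd j).integrable_mul ((hVij i j).mul (hu.pd i).continuous)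
  have i3 : Integrable (fun x => ∑ i, pd i f x * pd i u x) (gibbs V) :=
    integrable_finsetSum _ fun i _ => (hu.pd i).integrable_mul (continuous_pd hf i)
  have i4 : Integrable (fun x => ∑ i, ∑ j, pd j (pd i u) x ^ 2
      + ∑ i, ∑ j, pd i (pd j V) x * pd i u x * pd j u x) (gibbs V) := i1.add i2
  have i5 : Integrable (fun x => -(2 * ∑ i, pd i f x * pd i u x)) (gibbs V) :=
    (i3.const_mul 2).neg
  rw [integral_genL_sq hV hu, integral_mul_genL_eq hV1 hf hu, mul_neg, ← integral_const_mul,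
    ← integral_neg, ← integral_sub i5 i4]
  refine integral_congr_ae (.of_forall fun x => ?_)
  simp only; ring

/-- Poincaré inequality for `1`-uniformly convex potentials. -/
lemma integral_sq_le_integral_grad_sq {V f : Euc n → ℝ} [IsFiniteMeasure (gibbs V)]
    (hV : ContDiff ℝ 2 V)
    (hconv : ∀ (x : Euc n) (v : Fin n → ℝ), ∑ i, v i ^ 2 ≤ ∑ i, ∑ j, pd i (pd j V) x * v i * v j)
    (hf : IsTest f) (hf0 : ∫ x, f x ∂(gibbs V) = 0) :
    ∫ x, f x ^ 2 ∂(gibbs V) ≤ ∫ x, ∑ i, pd i f x ^ 2 ∂(gibbs V) := by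
  have hV1 : ContDiff ℝ 1 V := hV.of_le (by norm_num)
  have hVij : ∀ i j, Continuous (pd i (pd j V)) := fun i j =>
    continuous_pd (contDiff_pd hV (by norm_num) j) i
  refine integral_sq_le_of_forall_genL hV1
    (hf.continuous.memLp_of_hasCompactSupport hf.2) hf0 fun u hu => ?_
  rw [integral_comb_genL hV hf.contDiff_one hu]
  have i1 : Integrable (fun x => ∑ i, ∑ j, pd j (pd i u) x ^ 2) (gibbs V) :=
    integrable_finsetSum _ fun i _ => integrable_finsetSum _ fun j _ => by
      simpa [pow_two] using ((hu.pd i).pd j).integrable_mul ((hu.pd i).pd j).continuous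
  have i2 : Integrable (fun x => ∑ i, ∑ j, pd i (pd j V) x * pd i u x * pd j u x) (gibbs V) :=
    integrable_finsetSum _ fun i _ => integrable_finsetSum _ fun j _ =>
      (hu.pd j).integrable_mul ((hVij i j).mul (hu.pd i).continuous)
  have i3 : Integrable (fun x => ∑ i, pd i f x * pd i u x) (gibbs V) :=
    integrable_finsetSum _ fun i _ => (hu.pd i).integrable_mul (hf.pd i).continuous
  refine integral_mono (((i3.const_mul 2).neg.sub i1).sub i2)
    (integrable_finsetSum _ fun i _ => by
      simpa [pow_two] using (hf.pd i).integrable_mul (hf.pd i).continuous) fun x => ?_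
  have h1 : 0 ≤ ∑ i, ∑ j, pd j (pd i u) x ^ 2 :=
    Finset.sum_nonneg fun i _ => Finset.sum_nonneg fun j _ => sq_nonneg _
  have h2 := hconv x fun i => pd i u x
  have h3 : 0 ≤ ∑ i, (pd i f x + pd i u x) ^ 2 := Finset.sum_nonneg fun i _ => sq_nonneg _
  have h4 : ∑ i, (pd i f x + pd i u x) ^ 2
      = ∑ i, pd i f x ^ 2 + 2 * ∑ i, pd i f x * pd i u x + ∑ i, pd i u x ^ 2 := by
    rw [Finset.mul_sum, ← Finset.sum_add_distrib, ← Finset.sum_add_distrib]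
    exact Finset.sum_congr rfl fun i _ => by ring
  simp only
  linarith

/-- Integration by parts against the radial field. -/
lemma integral_mul_radial {V f : Euc n → ℝ} [IsFiniteMeasure (gibbs V)] (hV : ContDiff ℝ 1 V)
    (hf : IsTest f) :
    ∫ x, f x * ∑ i, x i * pd i V x ∂(gibbs V)
      = ∫ x, (n * f x + ∑ i, x i * pd i f x) ∂(gibbs V) := by
  have hx : ∀ i : Fin n, ContDiff ℝ 1 (fun x : Euc n => x i) := fun i =>
    (EuclideanSpace.proj (𝕜 := ℝ) i : Euc n →L[ℝ] ℝ).contDiff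
  have i1 : ∀ i, Integrable (fun x => f x * (x i * pd i V x)) (gibbs V) := fun i => by
    simpa [mul_comm] using hf.integrable_mul ((hx i).continuous.mul (continuous_pd hV i))
  have i2 : ∀ i, Integrable (fun x : Euc n => x i * pd i f x) (gibbs V) := fun i =>
    (hf.pd i).integrable_mul (hx i).continuous
  have h : ∀ i, ∫ x, f x * (x i * pd i V x) ∂(gibbs V)
      = (∫ x, f x ∂(gibbs V)) + ∫ x, x i * pd i f x ∂(gibbs V) := by
    intro i
    have := integral_mul_pd_gibbs hV hf.contDiff_one (hx i) (Or.inl hf.2) i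
    simp_rw [pd_coord, if_true, mul_sub, mul_one] at this
    rw [integral_sub hf.integrable ((i1 i).congr (.of_forall fun x => by simp only; ring))] at this
    have e : ∫ x, f x * (pd i V x * x i) ∂(gibbs V) = ∫ x, f x * (x i * pd i V x) ∂(gibbs V) :=
      integral_congr_ae (.of_forall fun x => by simp only; ring)
    have e' : ∫ x, pd i f x * x i ∂(gibbs V) = ∫ x, x i * pd i f x ∂(gibbs V) :=
      integral_congr_ae (.of_forall fun x => by simp only; ring)
    rw [e, e'] at this
    linarith
  simp_rw [Finset.mul_sum]
  rw [integral_finsetSum _ fun i _ => i1 i,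
    integral_add (hf.integrable.const_mul _) (integrable_finsetSum _ fun i _ => i2 i),
    integral_finsetSum _ fun i _ => i2 i, integral_const_mul]
  simp [h, Finset.sum_add_distrib]

/-- The radial energy estimate for gradients of even test functions. -/
lemma integral_grad_sq_mul_radial_le {V u : Euc n → ℝ} [IsFiniteMeasure (gibbs V)] (hn : 1 ≤ n)
    (hV : ContDiff ℝ 2 V) (hVe : ∀ x, V (-x) = V x)
    (hconv : ∀ (x : Euc n) (v : Fin n → ℝ), ∑ i, v i ^ 2 ≤ ∑ i, ∑ j, pd i (pd j V) x * v i * v j)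
    (hu : IsTest u) (hue : ∀ x, u (-x) = u x) :
    ∫ x, (∑ j, pd j u x ^ 2) * (∑ i, x i * pd i V x - ∑ i, x i ^ 2) ∂(gibbs V)
      ≤ ((n : ℝ) + 1) / 2 * ∫ x, (∑ j, pd j u x ^ 2 + ∑ i, ∑ j, pd j (pd i u) x ^ 2)
        ∂(gibbs V) := by
  have hV1 : ContDiff ℝ 1 V := hV.of_le (by norm_num)
  have hx : ∀ i : Fin n, Continuous (fun x : Euc n => x i) := fun i =>
    (EuclideanSpace.proj (𝕜 := ℝ) i : Euc n →L[ℝ] ℝ).continuous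
  set f : Euc n → ℝ := fun x => ∑ j, pd j u x ^ 2 with hfdef
  set b : Euc n → ℝ := fun x => ∑ i, ∑ j, pd j (pd i u) x ^ 2 with hbdef
  have hf : IsTest f := isTest_sum fun j => by
    simpa [pow_two] using (hu.pd j).mul (hu.pd j)
  have hb : IsTest b := isTest_sum fun i => isTest_sum fun j => by
    simpa [pow_two] using ((hu.pd i).pd j).mul ((hu.pd i).pd j)
  have hpdf : ∀ i x, pd i f x = ∑ j, 2 * (pd j u x * pd i (pd j u) x) := fun i x => by
    have h1 : ∀ j, DifferentiableAt ℝ (fun x => pd j u x ^ 2) x := fun j =>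
      ((hu.pd j).differentiable x).pow 2
    rw [hfdef, pd_sum fun j _ => h1 j]
    refine Finset.sum_congr rfl fun j _ => ?_
    simp_rw [pow_two]
    rw [pd_mul ((hu.pd j).differentiable x) ((hu.pd j).differentiable x)]
    ring
  have hAB : ∫ x, f x ∂(gibbs V) ≤ ∫ x, b x ∂(gibbs V) := by
    have i1 : ∀ i, Integrable (fun x => pd i u x ^ 2) (gibbs V) := fun i => by
      simpa [pow_two] using (hu.pd i).integrable_mul (hu.pd i).continuous
    have i2 : ∀ i, Integrable (fun x => ∑ j, pd j (pd i u) x ^ 2) (gibbs V) := fun i =>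
      integrable_finsetSum _ fun j _ => by
        simpa [pow_two] using ((hu.pd i).pd j).integrable_mul ((hu.pd i).pd j).continuous
    rw [hfdef, hbdef, integral_finsetSum _ fun i _ => i1 i, integral_finsetSum _ fun i _ => i2 i]
    refine Finset.sum_le_sum fun i _ => integral_sq_le_integral_grad_sq hV hconv (hu.pd i) ?_
    have h1 := integral_comp_neg_gibbs hV.continuous hVe (pd i u)
    simp_rw [pd_neg_of_even hu.differentiable hue] at h1
    rw [integral_neg] at h1
    linarith
  have hle : ∫ x, f x * (∑ i, x i * pd i V x - ∑ i, x i ^ 2) ∂(gibbs V)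
      ≤ n * (∫ x, f x ∂(gibbs V)) + ∫ x, b x ∂(gibbs V) := by
    have hq : Continuous fun x : Euc n => ∑ i, x i ^ 2 :=
      continuous_finsetSum _ fun i _ => (hx i).pow 2
    have hr : Continuous fun x : Euc n => ∑ i, x i * pd i V x :=
      continuous_finsetSum _ fun i _ => (hx i).mul (continuous_pd hV1 i)
    have j1 : Integrable (fun x => f x * ∑ i, x i ^ 2) (gibbs V) := by
      simpa [mul_comm] using hf.integrable_mul hq
    have j2 : Integrable (fun x => f x * ∑ i, x i * pd i V x) (gibbs V) := by
      simpa [mul_comm] using hf.integrable_mul hr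
    have j3 : Integrable (fun x => n * f x + ∑ i, x i * pd i f x) (gibbs V) :=
      (hf.integrable.const_mul _).add
        (integrable_finsetSum _ fun i _ => (hf.pd i).integrable_mul (hx i))
    simp_rw [mul_sub]
    rw [integral_sub j2 j1, integral_mul_radial hV1 hf, ← integral_const_mul,
      ← integral_sub j3 j1, ← integral_add (hf.integrable.const_mul _) hb.integrable]
    refine integral_mono (j3.sub j1) ((hf.integrable.const_mul _).add hb.integrable) fun x => ?_
    have key : ∑ i, x i * pd i f x ≤ f x * ∑ i, x i ^ 2 + b x := by
      have e1 : f x * ∑ i, x i ^ 2 = ∑ i, ∑ j, pd j u x ^ 2 * x i ^ 2 := by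
        rw [hfdef, Finset.mul_sum]
        exact Finset.sum_congr rfl fun i _ => Finset.sum_mul _ _ _
      have e2 : b x = ∑ i, ∑ j, pd i (pd j u) x ^ 2 := Finset.sum_comm
      rw [e1, e2, ← Finset.sum_add_distrib]
      refine Finset.sum_le_sum fun i _ => ?_
      rw [hpdf, Finset.mul_sum, ← Finset.sum_add_distrib]
      refine Finset.sum_le_sum fun j _ => ?_
      nlinarith [sq_nonneg (pd j u x * x i - pd i (pd j u) x)]
    simp only
    linarith
  refine hle.trans ?_
  rw [integral_add hf.integrable hb.integrable]
  have hn' : (1 : ℝ) ≤ n := by exact_mod_cast hn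
  nlinarith [mul_le_mul_of_nonneg_left hAB (sub_nonneg.2 hn')]

/-- The local (infinitesimal) inequality. -/
lemma variance_le_integral {V g w : Euc n → ℝ} [IsFiniteMeasure (gibbs V)] (hn : 1 ≤ n)
    (hV : ContDiff ℝ 2 V) (hVe : ∀ x, V (-x) = V x)
    (hconv : ∀ (x : Euc n) (v : Fin n → ℝ), ∑ i, v i ^ 2 ≤ ∑ i, ∑ j, pd i (pd j V) x * v i * v j)
    (hg : ContDiff ℝ 1 g) (hge : ∀ x, g (-x) = g x) (hg2 : MemLp g 2 (gibbs V))
    (hw : Integrable w (gibbs V))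
    (hpt : ∀ (x : Euc n) (v : Fin n → ℝ), 0 ≤ w x + 2 * ∑ i, pd i g x * v i
      + (∑ i, ∑ j, pd i (pd j V) x * v i * v j - ∑ i, v i ^ 2)
      + 2 / ((n : ℝ) + 1) * ((∑ i, v i ^ 2) * (∑ i, x i * pd i V x - ∑ i, x i ^ 2))) :
    (∫ x, g x ^ 2 ∂(gibbs V)) * (gibbs V).real Set.univ - (∫ x, g x ∂(gibbs V)) ^ 2
      ≤ (gibbs V).real Set.univ * ∫ x, w x ∂(gibbs V) := by
  have hV1 : ContDiff ℝ 1 V := hV.of_le (by norm_num)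
  have hVij : ∀ i j, Continuous (pd i (pd j V)) := fun i j =>
    continuous_pd (contDiff_pd hV (by norm_num) j) i
  have hx : ∀ i : Fin n, Continuous (fun x : Euc n => x i) := fun i =>
    (EuclideanSpace.proj (𝕜 := ℝ) i : Euc n →L[ℝ] ℝ).continuous
  set Z := (gibbs V).real Set.univ with hZ
  have hZ0 : 0 ≤ Z := measureReal_nonneg
  rcases hZ0.eq_or_lt with hz | hz
  · have : gibbs V = 0 := by
      rw [← Measure.measure_univ_eq_zero]
      exact (measureReal_eq_zero_iff).1 hz.symm
    simp [this]
  set m := (∫ x, g x ∂(gibbs V)) / Z with hm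
  have ig := hg2.integrable one_le_two
  have h0 : ∫ x, (g x - m) ∂(gibbs V) = 0 := by
    rw [integral_sub ig (integrable_const _), integral_const, smul_eq_mul, hm, ← hZ]
    field_simp; ring
  have hmain := integral_sq_le_of_forall_even_genL (g := fun x => g x - m)
    (C := ∫ x, w x ∂(gibbs V)) hV1 hVe (hg2.sub (memLp_const m)) (fun x => by rw [hge]) h0 ?_
  · have e : ∫ x, (g x - m) ^ 2 ∂(gibbs V)
        = (∫ x, g x ^ 2 ∂(gibbs V)) - 2 * m * (∫ x, g x ∂(gibbs V)) + m ^ 2 * Z := by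
      have j1 : Integrable (fun x => g x ^ 2 - 2 * m * g x) (gibbs V) :=
        hg2.integrable_sq.sub (ig.const_mul _)
      have : m ^ 2 * Z = ∫ _, m ^ 2 ∂(gibbs V) := by
        rw [integral_const, smul_eq_mul, mul_comm]
      rw [this, ← integral_const_mul, ← integral_sub hg2.integrable_sq (ig.const_mul _),
        ← integral_add j1 (integrable_const _)]
      exact integral_congr_ae (.of_forall fun x => by simp only; ring)
    rw [e] at hmain
    have hmZ : m * Z = ∫ x, g x ∂(gibbs V) := by rw [hm]; field_simp
    rw [← hmZ] at hmain ⊢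
    nlinarith [mul_le_mul_of_nonneg_left hmain hZ0]
  intro u hu hue
  have e0 : ∫ x, (g x - m) * genL V u x ∂(gibbs V) = ∫ x, g x * genL V u x ∂(gibbs V) := by
    have hcL := continuous_genL hV1 hu
    have hsL := hasCompactSupport_genL V hu
    have j1 : Integrable (fun x => g x * genL V u x) (gibbs V) :=
      (hg.continuous.mul hcL).integrable_of_hasCompactSupport hsL.mul_left
    have j2 : Integrable (fun x => m * genL V u x) (gibbs V) :=
      (hcL.integrable_of_hasCompactSupport hsL).const_mul m
    simp_rw [sub_mul]
    rw [integral_sub j1 j2, integral_const_mul, integral_genL hV1 hu]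
    ring
  rw [e0, integral_comb_genL hV hg hu]
  have hrad := integral_grad_sq_mul_radial_le hn hV hVe hconv hu hue
  have i1 : Integrable (fun x => ∑ i, ∑ j, pd j (pd i u) x ^ 2) (gibbs V) :=
    integrable_finsetSum _ fun i _ => integrable_finsetSum _ fun j _ => by
      simpa [pow_two] using ((hu.pd i).pd j).integrable_mul ((hu.pd i).pd j).continuous
  have i2 : Integrable (fun x => ∑ i, ∑ j, pd i (pd j V) x * pd i u x * pd j u x) (gibbs V) :=
    integrable_finsetSum _ fun i _ => integrable_finsetSum _ fun j _ =>
      (hu.pd j).integrable_mul ((hVij i j).mul (hu.pd i).continuous)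
  have i3 : Integrable (fun x => ∑ i, pd i g x * pd i u x) (gibbs V) :=
    integrable_finsetSum _ fun i _ => (hu.pd i).integrable_mul (continuous_pd hg i)
  have hf : IsTest fun x => ∑ j, pd j u x ^ 2 := isTest_sum fun j => by
    simpa [pow_two] using (hu.pd j).mul (hu.pd j)
  have i4 : Integrable (fun x : Euc n => (∑ j, pd j u x ^ 2)
      * (∑ i, x i * pd i V x - ∑ i, x i ^ 2)) (gibbs V) := by
    have hc : Continuous fun x : Euc n => ∑ i, x i * pd i V x - ∑ i, x i ^ 2 :=
      (continuous_finsetSum _ fun i _ => (hx i).mul (continuous_pd hV1 i)).sub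
        (continuous_finsetSum _ fun i _ => (hx i).pow 2)
    simpa [mul_comm] using hf.integrable_mul hc
  have i5 : Integrable (fun x => ∑ j, pd j u x ^ 2 + ∑ i, ∑ j, pd j (pd i u) x ^ 2) (gibbs V) :=
    hf.integrable.add i1
  have hstep : ∫ x, (-(2 * ∑ i, pd i g x * pd i u x) - ∑ i, ∑ j, pd j (pd i u) x ^ 2
        - ∑ i, ∑ j, pd i (pd j V) x * pd i u x * pd j u x) ∂(gibbs V)
      ≤ ∫ x, (w x + 2 / ((n : ℝ) + 1) * ((∑ j, pd j u x ^ 2)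
        * (∑ i, x i * pd i V x - ∑ i, x i ^ 2))
        - (∑ j, pd j u x ^ 2 + ∑ i, ∑ j, pd j (pd i u) x ^ 2)) ∂(gibbs V) := by
    refine integral_mono (((i3.const_mul 2).neg.sub i1).sub i2)
      ((hw.add (i4.const_mul _)).sub i5) fun x => ?_
    have := hpt x fun i => pd i u x
    simp only
    linarith
  refine hstep.trans ?_
  have i6 : Integrable (fun x => w x + 2 / ((n : ℝ) + 1) * ((∑ j, pd j u x ^ 2)
        * (∑ i, x i * pd i V x - ∑ i, x i ^ 2))) (gibbs V) := hw.add (i4.const_mul _)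
  rw [integral_sub i6 i5, integral_add hw (i4.const_mul _), integral_const_mul]
  have hn0 : (0 : ℝ) < (n : ℝ) + 1 := by positivity
  have := mul_le_mul_of_nonneg_left hrad (show 0 ≤ 2 / ((n : ℝ) + 1) by positivity)
  rw [← mul_assoc, show 2 / ((n : ℝ) + 1) * (((n : ℝ) + 1) / 2) = 1 by field_simp, one_mul] at this
  linarith

lemma hasDerivAt_max_zero_pow (k : ℕ) (x : ℝ) :
    HasDerivAt (fun y : ℝ => max y 0 ^ (k + 2)) ((k + 2) * max x 0 ^ (k + 1)) x := by
  have hne : ∀ y : ℝ, y ≠ 0 →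
      HasDerivAt (fun y : ℝ => max y 0 ^ (k + 2)) ((k + 2) * max y 0 ^ (k + 1)) y := by
    intro y hy
    rcases hy.lt_or_gt with h | h
    · rw [max_eq_right h.le, zero_pow (by omega), mul_zero]
      refine (hasDerivAt_const y (0 : ℝ)).congr_of_eventuallyEq ?_
      filter_upwards [eventually_lt_nhds h] with z hz
      rw [max_eq_right hz.le, zero_pow (by omega)]
    · rw [max_eq_left h.le]
      have := hasDerivAt_pow (k + 2) y
      refine (this.congr_of_eventuallyEq ?_).congr_deriv (by push_cast; rfl)
      filter_upwards [eventually_gt_nhds h] with z hz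
      rw [max_eq_left hz.le]
  by_cases hx : x = 0
  · subst hx
    refine hasDerivAt_of_hasDerivAt_of_ne' (g := fun y => (k + 2) * max y 0 ^ (k + 1)) hne ?_ ?_ 0
    · exact Continuous.continuousAt (by fun_prop)
    · exact Continuous.continuousAt (by fun_prop)
  · exact hne x hx

/-- A `C²` convex penalty vanishing exactly on `[-1, 1]`. -/
def barrier (N s : ℝ) : ℝ := N * max (s ^ 2 - 1) 0 ^ 3

/-- The first derivative of `barrier`. -/
def barrierD (N s : ℝ) : ℝ := 6 * N * s * max (s ^ 2 - 1) 0 ^ 2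

/-- The second derivative of `barrier`. -/
def barrierDD (N s : ℝ) : ℝ :=
  N * (6 * max (s ^ 2 - 1) 0 ^ 2 + 24 * s ^ 2 * max (s ^ 2 - 1) 0)

lemma hasDerivAt_barrier (N s : ℝ) : HasDerivAt (barrier N) (barrierD N s) s := by
  have h := (hasDerivAt_max_zero_pow 1 (s ^ 2 - 1)).comp s ((hasDerivAt_pow 2 s).sub_const 1)
  refine (h.const_mul N).congr_deriv ?_
  unfold barrierD
  push_cast
  ring

lemma hasDerivAt_barrierD (N s : ℝ) : HasDerivAt (barrierD N) (barrierDD N s) s := by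
  have h := (hasDerivAt_max_zero_pow 0 (s ^ 2 - 1)).comp s ((hasDerivAt_pow 2 s).sub_const 1)
  refine (((hasDerivAt_id s).const_mul (6 * N)).mul h).congr_deriv ?_
  unfold barrierDD
  simp
  ring

lemma continuous_barrierDD (N : ℝ) : Continuous (barrierDD N) := by
  unfold barrierDD; fun_prop

lemma contDiff_barrierD (N : ℝ) : ContDiff ℝ 1 (barrierD N) := by
  rw [contDiff_one_iff_deriv]
  refine ⟨fun s => (hasDerivAt_barrierD N s).differentiableAt, ?_⟩
  rw [funext fun s => (hasDerivAt_barrierD N s).deriv]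
  exact continuous_barrierDD N

lemma contDiff_barrier (N : ℝ) : ContDiff ℝ 2 (barrier N) := by
  rw [show (2 : WithTop ℕ∞) = 1 + 1 by norm_num, contDiff_succ_iff_deriv]
  refine ⟨fun s => (hasDerivAt_barrier N s).differentiableAt, by simp, ?_⟩
  rw [funext fun s => (hasDerivAt_barrier N s).deriv]
  exact contDiff_barrierD N

lemma barrier_neg (N s : ℝ) : barrier N (-s) = barrier N s := by simp [barrier]

lemma barrierD_neg (N s : ℝ) : barrierD N (-s) = -barrierD N s := by simp [barrierD]

lemma barrier_nonneg {N : ℝ} (hN : 0 ≤ N) (s : ℝ) : 0 ≤ barrier N s := by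
  unfold barrier; positivity

lemma barrierDD_nonneg {N : ℝ} (hN : 0 ≤ N) (s : ℝ) : 0 ≤ barrierDD N s := by
  unfold barrierDD; positivity

lemma sq_mul_max_eq (s : ℝ) :
    s ^ 2 * max (s ^ 2 - 1) 0 = (max (s ^ 2 - 1) 0 + 1) * max (s ^ 2 - 1) 0 := by
  rcases le_total (s ^ 2 - 1) 0 with h | h
  · simp [max_eq_right h]
  · rw [max_eq_left h]; ring

lemma mul_barrierD_nonneg {N : ℝ} (hN : 0 ≤ N) (s : ℝ) : 0 ≤ s * barrierD N s := by
  have : s * barrierD N s = 6 * N * s ^ 2 * max (s ^ 2 - 1) 0 ^ 2 := by unfold barrierD; ring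
  rw [this]; positivity

lemma mul_barrierD_le {N : ℝ} (hN : 0 ≤ N) (s : ℝ) :
    s * barrierD N s ≤ 108 * barrier N s + 78 * N := by
  have e := sq_mul_max_eq s
  have hp : 0 ≤ max (s ^ 2 - 1) 0 := le_max_right _ _
  unfold barrierD barrier
  set p := max (s ^ 2 - 1) 0
  have e1 : s * (6 * N * s * p ^ 2) = N * (6 * ((p + 1) * p ^ 2)) := by
    linear_combination (6 * N * p) * e
  have h : 6 * ((p + 1) * p ^ 2) ≤ 108 * p ^ 3 + 78 := by
    nlinarith [mul_nonneg (add_nonneg hp zero_le_one) (sq_nonneg (p - 1)), pow_nonneg hp 3]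
  rw [e1]
  nlinarith [mul_le_mul_of_nonneg_left h hN]

lemma sq_mul_barrierDD_le {N : ℝ} (hN : 0 ≤ N) (s : ℝ) :
    s ^ 2 * barrierDD N s ≤ 108 * barrier N s + 78 * N := by
  have e := sq_mul_max_eq s
  have hp : 0 ≤ max (s ^ 2 - 1) 0 := le_max_right _ _
  unfold barrierDD barrier
  set p := max (s ^ 2 - 1) 0
  have e1 : s ^ 2 * (N * (6 * p ^ 2 + 24 * s ^ 2 * p))
      = N * (6 * ((p + 1) * p ^ 2) + 24 * ((p + 1) ^ 2 * p)) := by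
    linear_combination (N * (6 * p + 24 * s ^ 2 + 24 * (p + 1))) * e
  have h : 6 * ((p + 1) * p ^ 2) + 24 * ((p + 1) ^ 2 * p) ≤ 108 * p ^ 3 + 78 := by
    have h1 : p ^ 2 ≤ p ^ 3 + 1 := by
      nlinarith [mul_nonneg (add_nonneg hp zero_le_one) (sq_nonneg (p - 1)), pow_nonneg hp 3]
    have h2 : p ≤ p ^ 3 + 1 := by nlinarith [sq_nonneg (p - 1)]
    nlinarith
  rw [e1]
  nlinarith [mul_le_mul_of_nonneg_left h hN]

/-- The one-dimensional pointwise inequality behind the local estimate. -/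
lemma barrier_pointwise {N : ℝ} (hN : 0 ≤ N) (s b : ℝ) {q Q : ℝ} (hq : q ^ 2 ≤ Q) :
    0 ≤ b ^ 2 * (s * (barrierD N s + s * barrierDD N s))
      - 2 * (b * (barrierD N s + s * barrierDD N s) * q) + barrierDD N s * q ^ 2
      + Q * (s * barrierD N s) := by
  have h1 := mul_nonneg (barrierDD_nonneg hN s) (sq_nonneg (b * s - q))
  have h2 := mul_le_mul_of_nonneg_right hq (mul_barrierD_nonneg hN s)
  have h3 : 0 ≤ b ^ 2 * (s * barrierD N s) - 2 * (b * barrierD N s * q)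
      + q ^ 2 * (s * barrierD N s) := by
    have e := sq_mul_max_eq s
    unfold barrierD
    have hp : 0 ≤ max (s ^ 2 - 1) 0 := le_max_right _ _
    set p := max (s ^ 2 - 1) 0
    have : b ^ 2 * (s * (6 * N * s * p ^ 2)) - 2 * (b * (6 * N * s * p ^ 2) * q)
        + q ^ 2 * (s * (6 * N * s * p ^ 2))
        = 6 * N * p ^ 2 * (b * s - q) ^ 2 + 6 * N * q ^ 2 * p ^ 3 := by
      linear_combination (6 * N * q ^ 2 * p) * e
    rw [this]; positivity
  nlinarith

section Slab

variable {ι : Type*} [Fintype ι]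

/-- The penalty potential of the slabs `|⟪x, u k⟫ e k| ≤ 1`. -/
def slabPot (N : ℝ) (u : ι → Euc n) (e : ι → ℝ) (x : Euc n) : ℝ :=
  ∑ k, barrier N (⟪x, u k⟫ * e k)

/-- First variation of `slabPot` under `e k ↦ e k * exp (-t * β k)`. -/
def slabPotD (N : ℝ) (u : ι → Euc n) (β e : ι → ℝ) (x : Euc n) : ℝ :=
  ∑ k, -β k * (⟪x, u k⟫ * e k * barrierD N (⟪x, u k⟫ * e k))

/-- Second variation of `slabPot` under `e k ↦ e k * exp (-t * β k)`. -/
def slabPotDD (N : ℝ) (u : ι → Euc n) (β e : ι → ℝ) (x : Euc n) : ℝ :=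
  ∑ k, β k ^ 2 * (⟪x, u k⟫ * e k *
    (barrierD N (⟪x, u k⟫ * e k) + ⟪x, u k⟫ * e k * barrierDD N (⟪x, u k⟫ * e k)))

/-- The Gaussian potential plus the slab penalty. -/
def gaussPot (N : ℝ) (u : ι → Euc n) (e : ι → ℝ) (x : Euc n) : ℝ :=
  ‖x‖ ^ 2 / 2 + slabPot N u e x

lemma contDiff_slabCoord {m : WithTop ℕ∞} (u : Euc n) (c : ℝ) :
    ContDiff ℝ m (fun x : Euc n => ⟪x, u⟫ * c) :=
  (contDiff_id.inner ℝ contDiff_const).mul contDiff_const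

lemma pd_slabCoord (u : Euc n) (c : ℝ) (i : Fin n) (x : Euc n) :
    pd i (fun y : Euc n => ⟪y, u⟫ * c) x = u i * c := by
  have h : DifferentiableAt ℝ (fun y : Euc n => ⟪y, u⟫) x :=
    differentiableAt_id.inner ℝ (differentiableAt_const _)
  rw [pd_mul h (differentiableAt_const c), pd_inner]
  simp [pd]

lemma pd_half_norm_sq (i : Fin n) (x : Euc n) : pd i (fun y : Euc n => ‖y‖ ^ 2 / 2) x = x i := by
  have h : HasFDerivAt (fun y : Euc n => ‖y‖ ^ 2) (2 • innerSL ℝ x) x :=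
    (hasStrictFDerivAt_norm_sq x).hasFDerivAt
  have e : (fun y : Euc n => ‖y‖ ^ 2 / 2) = fun y => (1 / 2) * ‖y‖ ^ 2 := by ext y; ring
  rw [e, pd_const_mul h.differentiableAt]
  simp [pd, h.fderiv, EuclideanSpace.inner_single_right]

variable {N : ℝ} {u : ι → Euc n} {α β e : ι → ℝ}

lemma contDiff_slabPot : ContDiff ℝ 2 (slabPot N u e) :=
  ContDiff.sum fun k _ => (contDiff_barrier N).comp (contDiff_slabCoord (u k) (e k))

lemma contDiff_slabPotD : ContDiff ℝ 1 (slabPotD N u β e) :=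
  ContDiff.sum fun k _ => contDiff_const.mul ((contDiff_slabCoord (u k) (e k)).mul
    ((contDiff_barrierD N).comp (contDiff_slabCoord (u k) (e k))))

lemma continuous_slabPotDD : Continuous (slabPotDD N u β e) := by
  have hs : ∀ k, Continuous fun x : Euc n => ⟪x, u k⟫ * e k := fun k =>
    (contDiff_slabCoord (m := 0) (u k) (e k)).continuous
  exact continuous_finsetSum _ fun k _ => continuous_const.mul ((hs k).mul
    (((contDiff_barrierD N).continuous.comp (hs k)).add
      ((hs k).mul ((continuous_barrierDD N).comp (hs k)))))

lemma contDiff_half_norm_sq {m : WithTop ℕ∞} : ContDiff ℝ m (fun x : Euc n => ‖x‖ ^ 2 / 2) :=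
  (contDiff_norm_sq ℝ).div_const 2

lemma contDiff_gaussPot : ContDiff ℝ 2 (gaussPot N u e) :=
  contDiff_half_norm_sq.add contDiff_slabPot

lemma gaussPot_neg (x : Euc n) : gaussPot N u e (-x) = gaussPot N u e x := by
  simp [gaussPot, slabPot, inner_neg_left, barrier_neg]

lemma slabPotD_neg (x : Euc n) : slabPotD N u β e (-x) = slabPotD N u β e x := by
  simp [slabPotD, inner_neg_left, barrierD_neg]

lemma pd_gaussPot (i : Fin n) (x : Euc n) : pd i (gaussPot N u e) x
    = x i + ∑ k, barrierD N (⟪x, u k⟫ * e k) * (u k i * e k) := by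
  have hs : ∀ k, DifferentiableAt ℝ (fun x : Euc n => ⟪x, u k⟫ * e k) x := fun k =>
    (contDiff_slabCoord (m := 1) (u k) (e k)).differentiable one_ne_zero x
  have hb : ∀ k, DifferentiableAt ℝ (fun x : Euc n => barrier N (⟪x, u k⟫ * e k)) x := fun k =>
    (hasDerivAt_barrier N _).differentiableAt.comp x (hs k)
  unfold gaussPot slabPot
  rw [pd_add (contDiff_half_norm_sq.differentiable one_ne_zero x)
      (DifferentiableAt.fun_sum fun k _ => hb k), pd_half_norm_sq, pd_sum fun k _ => hb k]
  congr 1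
  refine Finset.sum_congr rfl fun k _ => ?_
  rw [pd_comp (f := fun x : Euc n => ⟪x, u k⟫ * e k) (hasDerivAt_barrier N _) (hs k), pd_slabCoord]

lemma pd_pd_gaussPot (i j : Fin n) (x : Euc n) : pd i (pd j (gaussPot N u e)) x
    = (if i = j then 1 else 0)
      + ∑ k, barrierDD N (⟪x, u k⟫ * e k) * (u k i * e k) * (u k j * e k) := by
  have hs : ∀ k, DifferentiableAt ℝ (fun x : Euc n => ⟪x, u k⟫ * e k) x := fun k =>
    (contDiff_slabCoord (m := 1) (u k) (e k)).differentiable one_ne_zero x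
  have hb : ∀ k, DifferentiableAt ℝ (fun x : Euc n => barrierD N (⟪x, u k⟫ * e k)) x := fun k =>
    (hasDerivAt_barrierD N _).differentiableAt.comp x (hs k)
  have hb' : ∀ k, DifferentiableAt ℝ
      (fun x : Euc n => u k j * e k * barrierD N (⟪x, u k⟫ * e k)) x := fun k =>
    (hb k).const_mul _
  have hx : DifferentiableAt ℝ (fun x : Euc n => x j) x :=
    (EuclideanSpace.proj (𝕜 := ℝ) j : Euc n →L[ℝ] ℝ).differentiableAt
  have e0 : pd j (gaussPot N u e)
      = fun x => x j + ∑ k, u k j * e k * barrierD N (⟪x, u k⟫ * e k) := by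
    ext y
    rw [pd_gaussPot]
    simp_rw [mul_comm]
  rw [e0, pd_add hx (DifferentiableAt.fun_sum fun k _ => hb' k), pd_coord,
    pd_sum fun k _ => hb' k]
  congr 1
  refine Finset.sum_congr rfl fun k _ => ?_
  rw [pd_const_mul (hb k), pd_comp (f := fun x : Euc n => ⟪x, u k⟫ * e k)
    (hasDerivAt_barrierD N _) (hs k), pd_slabCoord]
  ring

lemma pd_slabPotD (i : Fin n) (x : Euc n) : pd i (slabPotD N u β e) x
    = ∑ k, -β k * ((barrierD N (⟪x, u k⟫ * e k)
      + ⟪x, u k⟫ * e k * barrierDD N (⟪x, u k⟫ * e k)) * (u k i * e k)) := by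
  have hs : ∀ k, DifferentiableAt ℝ (fun x : Euc n => ⟪x, u k⟫ * e k) x := fun k =>
    (contDiff_slabCoord (m := 1) (u k) (e k)).differentiable one_ne_zero x
  have hb : ∀ k, DifferentiableAt ℝ (fun x : Euc n => barrierD N (⟪x, u k⟫ * e k)) x := fun k =>
    (hasDerivAt_barrierD N _).differentiableAt.comp x (hs k)
  have hb' : ∀ k, DifferentiableAt ℝ
      (fun x : Euc n => ⟪x, u k⟫ * e k * barrierD N (⟪x, u k⟫ * e k)) x := fun k =>
    (hs k).mul (hb k)
  unfold slabPotD
  rw [pd_sum fun k _ => (hb' k).const_mul _]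
  refine Finset.sum_congr rfl fun k _ => ?_
  rw [pd_const_mul (hb' k), pd_mul (hs k) (hb k), pd_slabCoord,
    pd_comp (f := fun x : Euc n => ⟪x, u k⟫ * e k) (hasDerivAt_barrierD N _) (hs k), pd_slabCoord]
  ring

lemma sum_hess_gaussPot (x : Euc n) (v : Fin n → ℝ) :
    ∑ i, ∑ j, pd i (pd j (gaussPot N u e)) x * v i * v j
      = ∑ i, v i ^ 2 + ∑ k, barrierDD N (⟪x, u k⟫ * e k) * (∑ i, u k i * e k * v i) ^ 2 := by
  simp_rw [pd_pd_gaussPot, add_mul, Finset.sum_add_distrib]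
  congr 1
  · simp [pow_two]
  · simp_rw [Finset.sum_mul, pow_two, Finset.sum_mul_sum, Finset.mul_sum]
    rw [Finset.sum_comm]
    have h : ∀ j, ∑ i, ∑ k, barrierDD N (⟪x, u k⟫ * e k) * (u k i * e k) * (u k j * e k)
          * v i * v j
        = ∑ k, ∑ i, barrierDD N (⟪x, u k⟫ * e k) * (u k i * e k) * (u k j * e k)
          * v i * v j := fun j => Finset.sum_comm
    simp_rw [h]
    rw [Finset.sum_comm]
    refine Finset.sum_congr rfl fun k _ => ?_
    rw [Finset.sum_comm]
    exact Finset.sum_congr rfl fun i _ => Finset.sum_congr rfl fun j _ => by ring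

lemma hess_gaussPot_ge (hN : 0 ≤ N) (x : Euc n) (v : Fin n → ℝ) :
    ∑ i, v i ^ 2 ≤ ∑ i, ∑ j, pd i (pd j (gaussPot N u e)) x * v i * v j := by
  rw [sum_hess_gaussPot]
  exact le_add_of_nonneg_right (Finset.sum_nonneg fun k _ =>
    mul_nonneg (barrierDD_nonneg hN _) (sq_nonneg _))

lemma sum_radial_gaussPot (x : Euc n) : ∑ i, x i * pd i (gaussPot N u e) x - ∑ i, x i ^ 2
    = ∑ k, ⟪x, u k⟫ * e k * barrierD N (⟪x, u k⟫ * e k) := by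
  simp_rw [pd_gaussPot, mul_add, Finset.sum_add_distrib, pow_two, add_sub_cancel_left,
    Finset.mul_sum]
  rw [Finset.sum_comm]
  refine Finset.sum_congr rfl fun k _ => ?_
  have : ⟪x, u k⟫ = ∑ i, x i * u k i := by
    rw [PiLp.inner_apply]
    exact Finset.sum_congr rfl fun i _ => by simp [mul_comm]
  rw [mul_comm (⟪x, u k⟫ * e k) (barrierD _ _)]
  nth_rewrite 3 [this]
  rw [Finset.sum_mul, Finset.mul_sum]
  exact Finset.sum_congr rfl fun i _ => by ring

lemma slab_pointwise (hN : 0 ≤ N) (hu : ∀ k, ‖u k‖ = 1) (he : ∀ k, e k ^ 2 ≤ 2 / ((n : ℝ) + 1))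
    (x : Euc n) (v : Fin n → ℝ) :
    0 ≤ slabPotDD N u β e x + 2 * ∑ i, pd i (slabPotD N u β e) x * v i
      + (∑ i, ∑ j, pd i (pd j (gaussPot N u e)) x * v i * v j - ∑ i, v i ^ 2)
      + 2 / ((n : ℝ) + 1) * ((∑ i, v i ^ 2)
        * (∑ i, x i * pd i (gaussPot N u e) x - ∑ i, x i ^ 2)) := by
  have h1 : ∑ i, pd i (slabPotD N u β e) x * v i
      = ∑ k, -(β k * (barrierD N (⟪x, u k⟫ * e k)
        + ⟪x, u k⟫ * e k * barrierDD N (⟪x, u k⟫ * e k)) * ∑ i, u k i * e k * v i) := by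
    simp_rw [pd_slabPotD, Finset.sum_mul]
    rw [Finset.sum_comm]
    refine Finset.sum_congr rfl fun k _ => ?_
    rw [Finset.mul_sum, ← Finset.sum_neg_distrib]
    exact Finset.sum_congr rfl fun i _ => by ring
  rw [h1, sum_hess_gaussPot, sum_radial_gaussPot, add_sub_cancel_left, slabPotDD, Finset.mul_sum,
    ← mul_assoc, Finset.mul_sum, ← Finset.sum_add_distrib, ← Finset.sum_add_distrib,
    ← Finset.sum_add_distrib]
  refine Finset.sum_nonneg fun k _ => ?_
  have hq : (∑ i, u k i * e k * v i) ^ 2 ≤ 2 / ((n : ℝ) + 1) * ∑ i, v i ^ 2 := by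
    refine (Finset.sum_mul_sq_le_sq_mul_sq _ _ _).trans ?_
    refine mul_le_mul_of_nonneg_right ?_ (Finset.sum_nonneg fun i _ => sq_nonneg _)
    have h2 : ∑ i, (u k i * e k) ^ 2 = e k ^ 2 := by
      have h3 := EuclideanSpace.real_norm_sq_eq (u k)
      rw [hu k] at h3
      simp_rw [mul_pow]
      rw [← Finset.sum_mul, ← h3]; ring
    rw [h2]; exact he k
  have := barrier_pointwise hN (⟪x, u k⟫ * e k) (β k) hq
  linarith

lemma slabPot_nonneg (hN : 0 ≤ N) (x : Euc n) : 0 ≤ slabPot N u e x :=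
  Finset.sum_nonneg fun _ _ => barrier_nonneg hN _

lemma barrier_le_slabPot (hN : 0 ≤ N) (x : Euc n) (k : ι) :
    barrier N (⟪x, u k⟫ * e k) ≤ slabPot N u e x :=
  Finset.single_le_sum (f := fun k => barrier N (⟪x, u k⟫ * e k))
    (fun _ _ => barrier_nonneg hN _) (Finset.mem_univ k)

lemma exists_slabPot_bound (hN : 0 ≤ N) (u : ι → Euc n) (β : ι → ℝ) : ∃ C : ℝ, 0 ≤ C ∧
    ∀ e x, |slabPotD N u β e x| ≤ C * (1 + slabPot N u e x) ∧
      |slabPotDD N u β e x| ≤ C * (1 + slabPot N u e x) := by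
  refine ⟨(∑ k, (|β k| + 2 * β k ^ 2)) * (108 + 78 * N), by positivity, fun e x => ?_⟩
  have hW := slabPot_nonneg (u := u) (e := e) hN x
  have hb : ∀ k, 108 * barrier N (⟪x, u k⟫ * e k) + 78 * N
      ≤ (108 + 78 * N) * (1 + slabPot N u e x) := fun k => by
    have := barrier_le_slabPot (u := u) (e := e) hN x k
    nlinarith [mul_nonneg hN hW]
  have hR : 0 ≤ (108 + 78 * N) * (1 + slabPot N u e x) := by positivity
  rw [mul_assoc, Finset.sum_mul]
  constructor
  · refine (Finset.abs_sum_le_sum_abs _ _).trans (Finset.sum_le_sum fun k _ => ?_)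
    rw [abs_mul, abs_neg, abs_of_nonneg (mul_barrierD_nonneg hN _)]
    have h1 := mul_le_mul_of_nonneg_left ((mul_barrierD_le hN _).trans (hb k)) (abs_nonneg (β k))
    have h2 : 0 ≤ 2 * β k ^ 2 * ((108 + 78 * N) * (1 + slabPot N u e x)) := by positivity
    linarith
  · refine (Finset.abs_sum_le_sum_abs _ _).trans (Finset.sum_le_sum fun k _ => ?_)
    set s := ⟪x, u k⟫ * e k
    have h0 : s * (barrierD N s + s * barrierDD N s) = s * barrierD N s + s ^ 2 * barrierDD N s := by
      ring
    have h00 : 0 ≤ s * (barrierD N s + s * barrierDD N s) := by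
      rw [h0]
      exact add_nonneg (mul_barrierD_nonneg hN _)
        (mul_nonneg (sq_nonneg _) (barrierDD_nonneg hN _))
    rw [abs_of_nonneg (mul_nonneg (sq_nonneg _) h00), h0]
    have h1 := mul_le_mul_of_nonneg_left (add_le_add ((mul_barrierD_le hN s).trans (hb k))
      ((sq_mul_barrierDD_le hN s).trans (hb k))) (sq_nonneg (β k))
    have h2 : 0 ≤ |β k| * ((108 + 78 * N) * (1 + slabPot N u e x)) := by positivity
    linarith

lemma one_add_sq_mul_exp_neg_le {w : ℝ} (hw : 0 ≤ w) : (1 + w) ^ 2 * Real.exp (-w) ≤ 4 := by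
  have h1 : 1 + w ≤ 2 * Real.exp (w / 2) := by linarith [Real.add_one_le_exp (w / 2)]
  have h2 : (1 + w) ^ 2 ≤ (2 * Real.exp (w / 2)) ^ 2 := by gcongr
  have h3 : (2 * Real.exp (w / 2)) ^ 2 * Real.exp (-w) = 4 := by
    rw [mul_pow, ← Real.exp_nat_mul, mul_assoc, ← Real.exp_add]
    norm_num
    ring
  calc _ ≤ (2 * Real.exp (w / 2)) ^ 2 * Real.exp (-w) := by gcongr
    _ = 4 := h3

lemma integrable_exp_neg_half_norm_sq : Integrable fun x : Euc n => Real.exp (-(‖x‖ ^ 2 / 2)) := by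
  have := GaussianFourier.integrable_cexp_neg_mul_sq_norm_add (V := Euc n) (b := 1 / 2)
    (by norm_num) 0 0
  refine this.re.congr (.of_forall fun x => ?_)
  have e : -(1 / 2 : ℂ) * (‖x‖ : ℂ) ^ 2 + 0 * (⟪(0 : Euc n), x⟫ : ℝ)
      = ((-(‖x‖ ^ 2 / 2) : ℝ) : ℂ) := by
    push_cast; ring
  change (Complex.exp _).re = _
  rw [e, Complex.exp_ofReal_re]

/-- Functions of growth `(1 + W)²` are integrable against `e^{-V}`, with a uniform bound. -/
lemma abs_mul_exp_neg_gaussPot_le (hN : 0 ≤ N) {f C : ℝ} {x : Euc n}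
    (hC : 0 ≤ C) (hf : |f| ≤ C * (1 + slabPot N u e x) ^ 2) :
    ‖f * Real.exp (-gaussPot N u e x)‖ ≤ 4 * C * Real.exp (-(‖x‖ ^ 2 / 2)) := by
  have hW := slabPot_nonneg (u := u) (e := e) hN x
  rw [norm_mul, Real.norm_eq_abs, Real.norm_of_nonneg (Real.exp_pos _).le, gaussPot, neg_add,
    Real.exp_add]
  have h := mul_le_mul_of_nonneg_left (one_add_sq_mul_exp_neg_le hW) hC
  calc |f| * (Real.exp (-(‖x‖ ^ 2 / 2)) * Real.exp (-slabPot N u e x))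
      ≤ C * (1 + slabPot N u e x) ^ 2
        * (Real.exp (-(‖x‖ ^ 2 / 2)) * Real.exp (-slabPot N u e x)) := by gcongr
    _ = C * ((1 + slabPot N u e x) ^ 2 * Real.exp (-slabPot N u e x))
        * Real.exp (-(‖x‖ ^ 2 / 2)) := by ring
    _ ≤ C * 4 * Real.exp (-(‖x‖ ^ 2 / 2)) := by gcongr
    _ = _ := by ring

lemma integrable_gaussPot_of_bound (hN : 0 ≤ N) {f : Euc n → ℝ} (hfc : Continuous f) {C : ℝ}
    (hC : 0 ≤ C) (hf : ∀ x, |f x| ≤ C * (1 + slabPot N u e x) ^ 2) :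
    Integrable f (gibbs (gaussPot N u e)) := by
  have hV : Continuous (gaussPot N u e) := contDiff_gaussPot.continuous
  rw [integrable_gibbs hV]
  exact (integrable_exp_neg_half_norm_sq.const_mul (4 * C)).mono'
    (hfc.mul (Real.continuous_exp.comp hV.neg)).aestronglyMeasurable
    (.of_forall fun x => abs_mul_exp_neg_gaussPot_le hN hC (hf x))

lemma isFiniteMeasure_gibbs_gaussPot (hN : 0 ≤ N) : IsFiniteMeasure (gibbs (gaussPot N u e)) := by
  have h : Integrable (fun _ => (1 : ℝ)) (gibbs (gaussPot N u e)) :=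
    integrable_gaussPot_of_bound hN continuous_const zero_le_one fun x => by
      have hW := slabPot_nonneg (u := u) (e := e) hN x
      rw [abs_one]; nlinarith
  exact (integrable_const_iff_isFiniteMeasure one_ne_zero).1 h

end Slab

section SlabTime

/-- The intersection of the slabs `|⟪x, u k⟫ e k| ≤ 1`. -/
def slabs {ι : Type*} (u : ι → Euc n) (e : ι → ℝ) : Set (Euc n) := {x | ∀ k, |⟪x, u k⟫ * e k| ≤ 1}

lemma isClosed_slabs {ι : Type*} (u : ι → Euc n) (e : ι → ℝ) : IsClosed (slabs u e) := by
  simp only [slabs, Set.ofPred_forall]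
  exact isClosed_iInter fun k => isClosed_le
    (contDiff_slabCoord (m := 0) (u k) (e k)).continuous.abs continuous_const

variable {ι : Type*} [Fintype ι] {N : ℝ} {u : ι → Euc n} {α β : ι → ℝ}

/-- The inverse half-width `exp (-(α k + t β k))` of the `k`-th slab. -/
def invWidth (α β : ι → ℝ) (t : ℝ) (k : ι) : ℝ := Real.exp (-(α k + t * β k))

lemma hasDerivAt_mul_invWidth {ι : Type*} {α β : ι → ℝ} (c t : ℝ) (k : ι) :
    HasDerivAt (fun t => c * invWidth α β t k) (-β k * (c * invWidth α β t k)) t := by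
  have h : HasDerivAt (fun t => -(α k + t * β k)) (-β k) t :=
    ((hasDerivAt_mul_const (β k)).const_add (α k)).fun_neg
  refine (h.exp.const_mul c).congr_deriv ?_
  unfold invWidth; ring

lemma hasDerivAt_slabPot (x : Euc n) (t : ℝ) :
    HasDerivAt (fun t => slabPot N u (invWidth α β t) x)
      (slabPotD N u β (invWidth α β t) x) t := by
  refine HasDerivAt.fun_sum fun k _ => ?_
  refine ((hasDerivAt_barrier N _).comp t (hasDerivAt_mul_invWidth _ t k)).congr_deriv ?_
  ring

lemma hasDerivAt_slabPotD (x : Euc n) (t : ℝ) :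
    HasDerivAt (fun t => slabPotD N u β (invWidth α β t) x)
      (slabPotDD N u β (invWidth α β t) x) t := by
  refine HasDerivAt.fun_sum fun k _ => ?_
  have h := hasDerivAt_mul_invWidth (α := α) (β := β) ⟪x, u k⟫ t k
  refine ((h.mul ((hasDerivAt_barrierD N _).comp t h)).const_mul (-β k)).congr_deriv ?_
  simp only [Function.comp_apply]
  ring

lemma hasDerivAt_exp_neg_gaussPot (x : Euc n) (t : ℝ) :
    HasDerivAt (fun t => Real.exp (-gaussPot N u (invWidth α β t) x))
      (-slabPotD N u β (invWidth α β t) x * Real.exp (-gaussPot N u (invWidth α β t) x)) t := by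
  have h : HasDerivAt (fun t => -gaussPot N u (invWidth α β t) x)
      (-slabPotD N u β (invWidth α β t) x) t :=
    ((hasDerivAt_slabPot x t).const_add (‖x‖ ^ 2 / 2)).neg
  exact h.exp.congr_deriv (mul_comm _ _)

lemma hasDerivAt_slabPotD_mul_exp (x : Euc n) (t : ℝ) :
    HasDerivAt
      (fun t => -slabPotD N u β (invWidth α β t) x * Real.exp (-gaussPot N u (invWidth α β t) x))
      ((slabPotD N u β (invWidth α β t) x ^ 2 - slabPotDD N u β (invWidth α β t) x)
        * Real.exp (-gaussPot N u (invWidth α β t) x)) t := by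
  refine ((hasDerivAt_slabPotD x t).neg.mul (hasDerivAt_exp_neg_gaussPot x t)).congr_deriv ?_
  simp only [Pi.neg_apply]
  ring

/-- Differentiation of Gaussian-type integrals in a parameter with a global Gaussian bound. -/
lemma hasDerivAt_integral_of_gaussian_bound {F F' : ℝ → Euc n → ℝ} {C : ℝ}
    (hF : ∀ t, Continuous (F t)) (hF' : ∀ t, Continuous (F' t))
    (hFb : ∀ t x, ‖F t x‖ ≤ C * Real.exp (-(‖x‖ ^ 2 / 2)))
    (hFb' : ∀ t x, ‖F' t x‖ ≤ C * Real.exp (-(‖x‖ ^ 2 / 2)))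
    (hd : ∀ x t, HasDerivAt (fun t => F t x) (F' t x) t) (t : ℝ) :
    HasDerivAt (fun t => ∫ x, F t x) (∫ x, F' t x) t :=
  (hasDerivAt_integral_of_dominated_loc_of_deriv_le (bound := fun x => C *
      Real.exp (-(‖x‖ ^ 2 / 2))) (s := Set.univ) Filter.univ_mem
    (.of_forall fun t => (hF t).aestronglyMeasurable)
    ((integrable_exp_neg_half_norm_sq.const_mul C).mono' (hF t).aestronglyMeasurable
      (.of_forall (hFb t)))
    (hF' t).aestronglyMeasurable (.of_forall fun x t _ => hFb' t x)
    (integrable_exp_neg_half_norm_sq.const_mul C)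
    (.of_forall fun x t _ => hd x t)).2

lemma one_le_one_add_slabPot (hN : 0 ≤ N) (e : ι → ℝ) (x : Euc n) :
    1 ≤ 1 + slabPot N u e x := le_add_of_nonneg_right (slabPot_nonneg hN x)

/-- Log-concavity of the smoothed slab measure in the parameter. -/
lemma concaveOn_log_integral (hn : 1 ≤ n) (hN : 0 ≤ N) (hu : ∀ k, ‖u k‖ = 1)
    (he : ∀ t ∈ Set.Icc (0 : ℝ) 1, ∀ k, invWidth α β t k ^ 2 ≤ 2 / ((n : ℝ) + 1)) :
    ConcaveOn ℝ (Set.Icc 0 1)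
      fun t => Real.log (∫ x, Real.exp (-gaussPot N u (invWidth α β t) x)) := by
  obtain ⟨C, hC, hCb⟩ := exists_slabPot_bound hN u β
  set E := invWidth α β with hE
  have h1W : ∀ e x, 1 ≤ 1 + slabPot N u e x := one_le_one_add_slabPot hN
  set K := 4 * (1 + C + C ^ 2) with hK
  have b0 : ∀ (e : ι → ℝ) (x : Euc n), |(1 : ℝ)| ≤ (1 + C + C ^ 2) * (1 + slabPot N u e x) ^ 2 := by
    intro e x
    rw [abs_one]
    have := one_le_pow₀ (n := 2) (h1W e x)
    nlinarith [mul_nonneg hC hC]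
  have b1 : ∀ (e : ι → ℝ) (x : Euc n), |-slabPotD N u β e x|
      ≤ (1 + C + C ^ 2) * (1 + slabPot N u e x) ^ 2 := by
    intro e x
    rw [abs_neg]
    refine (hCb e x).1.trans ?_
    have h := h1W e x
    set y := 1 + slabPot N u e x
    have hy : y ≤ y ^ 2 := by nlinarith
    have := mul_le_mul_of_nonneg_left hy hC
    nlinarith [sq_nonneg y, sq_nonneg (C * y)]
  have b2 : ∀ (e : ι → ℝ) (x : Euc n), |slabPotD N u β e x ^ 2 - slabPotDD N u β e x|
      ≤ (1 + C + C ^ 2) * (1 + slabPot N u e x) ^ 2 := by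
    intro e x
    obtain ⟨h1, h2⟩ := hCb e x
    have h := h1W e x
    set y := 1 + slabPot N u e x
    have hy : y ≤ y ^ 2 := by nlinarith
    have h3 := mul_le_mul_of_nonneg_left hy hC
    have h4 : slabPotD N u β e x ^ 2 ≤ (C * y) ^ 2 := sq_le_sq' (by linarith [(abs_le.1 h1).1])
      (abs_le.1 h1).2
    have h5 := abs_sub (slabPotD N u β e x ^ 2) (slabPotDD N u β e x)
    rw [abs_of_nonneg (sq_nonneg (slabPotD N u β e x))] at h5
    nlinarith [sq_nonneg y]
  have hK0 : 0 ≤ 1 + C + C ^ 2 := by positivity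
  have hV : ∀ e, Continuous (gaussPot N u e) := fun e => contDiff_gaussPot.continuous
  have cE : ∀ e, Continuous fun x => Real.exp (-gaussPot N u e x) := fun e =>
    Real.continuous_exp.comp (hV e).neg
  have cD : ∀ e, Continuous (slabPotD N u β e) := fun e => contDiff_slabPotD.continuous
  have c1 : ∀ e, Continuous fun x => -slabPotD N u β e x * Real.exp (-gaussPot N u e x) :=
    fun e => (cD e).neg.mul (cE e)
  have c2 : ∀ e, Continuous fun x => (slabPotD N u β e x ^ 2 - slabPotDD N u β e x)
      * Real.exp (-gaussPot N u e x) :=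
    fun e => (((cD e).pow 2).sub continuous_slabPotDD).mul (cE e)
  have d1 : ∀ t, HasDerivAt (fun t => ∫ x, Real.exp (-gaussPot N u (E t) x))
      (∫ x, -slabPotD N u β (E t) x * Real.exp (-gaussPot N u (E t) x)) t :=
    hasDerivAt_integral_of_gaussian_bound (C := K) (fun t => cE _) (fun t => c1 _)
      (fun t x => by simpa using abs_mul_exp_neg_gaussPot_le hN hK0 (b0 (E t) x))
      (fun t x => abs_mul_exp_neg_gaussPot_le hN hK0 (b1 (E t) x))
      (fun x t => hasDerivAt_exp_neg_gaussPot x t)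
  have d2 : ∀ t, HasDerivAt
      (fun t => ∫ x, -slabPotD N u β (E t) x * Real.exp (-gaussPot N u (E t) x))
      (∫ x, (slabPotD N u β (E t) x ^ 2 - slabPotDD N u β (E t) x)
        * Real.exp (-gaussPot N u (E t) x)) t :=
    hasDerivAt_integral_of_gaussian_bound (C := K) (fun t => c1 _) (fun t => c2 _)
      (fun t x => abs_mul_exp_neg_gaussPot_le hN hK0 (b1 (E t) x))
      (fun t x => abs_mul_exp_neg_gaussPot_le hN hK0 (b2 (E t) x))
      (fun x t => hasDerivAt_slabPotD_mul_exp x t)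
  have hpos : ∀ t, 0 < ∫ x, Real.exp (-gaussPot N u (E t) x) := fun t =>
    integral_exp_pos ((integrable_exp_neg_half_norm_sq.const_mul K).mono'
      (cE (E t)).aestronglyMeasurable
      (.of_forall fun x => by simpa using abs_mul_exp_neg_gaussPot_le hN hK0 (b0 (E t) x)))
  have d3 : ∀ t, HasDerivAt (fun t => Real.log (∫ x, Real.exp (-gaussPot N u (E t) x)))
      ((∫ x, -slabPotD N u β (E t) x * Real.exp (-gaussPot N u (E t) x))
        / ∫ x, Real.exp (-gaussPot N u (E t) x)) t := fun t => (d1 t).log (hpos t).ne'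
  have d4 := fun t => (d2 t).div (d1 t) (hpos t).ne'
  refine concaveOn_of_hasDerivWithinAt2_nonpos (convex_Icc 0 1)
    (fun t _ => (d3 t).continuousAt.continuousWithinAt)
    (fun t _ => (d3 t).hasDerivWithinAt) (fun t _ => (d4 t).hasDerivWithinAt) fun t ht => ?_
  refine div_nonpos_of_nonpos_of_nonneg ?_ (sq_nonneg _)
  have ht' : t ∈ Set.Icc (0 : ℝ) 1 := interior_subset ht
  have : IsFiniteMeasure (gibbs (gaussPot N u (E t))) := isFiniteMeasure_gibbs_gaussPot hN
  have iD2 : Integrable (fun x => slabPotD N u β (E t) x ^ 2) (gibbs (gaussPot N u (E t))) :=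
    integrable_gaussPot_of_bound hN ((cD _).pow 2) (sq_nonneg C) fun x => by
      rw [abs_of_nonneg (sq_nonneg _), ← mul_pow]
      have := (hCb (E t) x).1
      exact sq_le_sq' (by linarith [(abs_le.1 this).1]) (abs_le.1 this).2
  have iDD : Integrable (slabPotDD N u β (E t)) (gibbs (gaussPot N u (E t))) :=
    integrable_gaussPot_of_bound hN continuous_slabPotDD hC fun x => by
      refine (hCb (E t) x).2.trans (mul_le_mul_of_nonneg_left ?_ hC)
      nlinarith [h1W (E t) x]
  have hloc := variance_le_integral (g := slabPotD N u β (E t)) (w := slabPotDD N u β (E t)) hn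
    contDiff_gaussPot gaussPot_neg (hess_gaussPot_ge hN) contDiff_slabPotD slabPotD_neg
    ((memLp_two_iff_integrable_sq (cD _).aestronglyMeasurable).2 iD2) iDD
    (slab_pointwise hN hu (he t ht'))
  have hZ : (gibbs (gaussPot N u (E t))).real Set.univ = ∫ x, Real.exp (-gaussPot N u (E t) x) := by
    have := integral_gibbs (hV (E t)) fun _ => 1
    simpa using this
  have e1 : ∫ x, -slabPotD N u β (E t) x * Real.exp (-gaussPot N u (E t) x)
      = -∫ x, slabPotD N u β (E t) x ∂(gibbs (gaussPot N u (E t))) := by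
    rw [← integral_neg, integral_gibbs (hV (E t))]
  have e2 : ∫ x, (slabPotD N u β (E t) x ^ 2 - slabPotDD N u β (E t) x)
        * Real.exp (-gaussPot N u (E t) x)
      = (∫ x, slabPotD N u β (E t) x ^ 2 ∂(gibbs (gaussPot N u (E t))))
        - ∫ x, slabPotDD N u β (E t) x ∂(gibbs (gaussPot N u (E t))) := by
    rw [← integral_sub iD2 iDD, integral_gibbs (hV (E t))]
  rw [hZ] at hloc
  rw [e1, e2]
  linarith

lemma rpow_integral_le (hn : 1 ≤ n) (hN : 0 ≤ N) (hu : ∀ k, ‖u k‖ = 1)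
    (he : ∀ t ∈ Set.Icc (0 : ℝ) 1, ∀ k, invWidth α β t k ^ 2 ≤ 2 / ((n : ℝ) + 1))
    {t : ℝ} (ht : t ∈ Set.Icc (0 : ℝ) 1) :
    (∫ x, Real.exp (-gaussPot N u (invWidth α β 1) x)) ^ t
      * (∫ x, Real.exp (-gaussPot N u (invWidth α β 0) x)) ^ (1 - t)
      ≤ ∫ x, Real.exp (-gaussPot N u (invWidth α β t) x) := by
  have h := (concaveOn_log_integral hn hN hu he).2 (x := 1) (y := 0) (by simp) (by simp) ht.1
    (sub_nonneg.2 ht.2) (by ring)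
  have hpos : ∀ t, 0 < ∫ x, Real.exp (-gaussPot N u (invWidth α β t) x) := fun t => by
    have := isFiniteMeasure_gibbs_gaussPot (u := u) (e := invWidth α β t) hN
    have hi := integrable_const (μ := gibbs (gaussPot N u (invWidth α β t))) (1 : ℝ)
    rw [integrable_gibbs contDiff_gaussPot.continuous] at hi
    exact integral_exp_pos (by simpa using hi)
  simp only [smul_eq_mul, mul_one, mul_zero, add_zero] at h
  rw [← Real.log_le_log_iff (mul_pos (Real.rpow_pos_of_pos (hpos 1) _)
    (Real.rpow_pos_of_pos (hpos 0) _)) (hpos t), Real.log_mul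
    (Real.rpow_pos_of_pos (hpos 1) _).ne' (Real.rpow_pos_of_pos (hpos 0) _).ne',
    Real.log_rpow (hpos 1), Real.log_rpow (hpos 0)]
  exact h

lemma tendsto_exp_neg_slabPot (u : ι → Euc n) (e : ι → ℝ) (x : Euc n) :
    Filter.Tendsto (fun N : ℕ => Real.exp (-slabPot N u e x)) Filter.atTop
      (nhds ((slabs u e).indicator 1 x)) := by
  have hmul : ∀ N : ℕ, slabPot N u e x = N * slabPot 1 u e x := fun N => by
    simp [slabPot, barrier, Finset.mul_sum]
  by_cases hx : x ∈ slabs u e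
  · have h0 : slabPot 1 u e x = 0 := Finset.sum_eq_zero fun k _ => by
      have : (⟪x, u k⟫ * e k) ^ 2 ≤ 1 := (sq_le_one_iff_abs_le_one _).2 (hx k)
      simp [barrier, max_eq_right (sub_nonpos.2 this)]
    simp [hmul, h0, hx]
  · have h0 : 0 < slabPot 1 u e x := by
      simp only [slabs, Set.mem_ofPred_eq, not_forall, not_le] at hx
      obtain ⟨k, hk⟩ := hx
      refine lt_of_lt_of_le ?_ (barrier_le_slabPot zero_le_one x k)
      have : 1 < (⟪x, u k⟫ * e k) ^ 2 := (one_lt_sq_iff_one_lt_abs _).2 hk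
      unfold barrier
      rw [max_eq_left (sub_nonneg.2 this.le), one_mul]
      exact pow_pos (sub_pos.2 this) 3
    rw [Set.indicator_of_notMem hx]
    simp_rw [hmul]
    exact Real.tendsto_exp_neg_atTop_nhds_zero.comp
      (tendsto_natCast_atTop_atTop.atTop_mul_const h0)

lemma isFiniteMeasure_gibbs_half_norm_sq :
    IsFiniteMeasure (gibbs fun x : Euc n => ‖x‖ ^ 2 / 2) := by
  rw [← integrable_const_iff_isFiniteMeasure (one_ne_zero (α := ℝ)),
    integrable_gibbs (by fun_prop)]
  simpa using integrable_exp_neg_half_norm_sq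

lemma tendsto_integral_gaussPot (u : ι → Euc n) (e : ι → ℝ) :
    Filter.Tendsto (fun N : ℕ => ∫ x, Real.exp (-gaussPot N u e x)) Filter.atTop
      (nhds ((gibbs fun x : Euc n => ‖x‖ ^ 2 / 2).real (slabs u e))) := by
  have hV : Continuous fun x : Euc n => ‖x‖ ^ 2 / 2 := by fun_prop
  have hm := (isClosed_slabs u e).measurableSet
  rw [← integral_indicator_one hm, integral_gibbs hV]
  refine tendsto_integral_of_dominated_convergence (fun x => Real.exp (-(‖x‖ ^ 2 / 2)))
    (fun N => (Real.continuous_exp.comp contDiff_gaussPot.continuous.neg).aestronglyMeasurable)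
    integrable_exp_neg_half_norm_sq (fun N => .of_forall fun x => ?_) (.of_forall fun x => ?_)
  · rw [Real.norm_of_nonneg (Real.exp_pos _).le, Real.exp_le_exp, gaussPot]
    linarith [slabPot_nonneg (u := u) (e := e) N.cast_nonneg x]
  · have e1 : ∀ N : ℕ, Real.exp (-gaussPot N u e x)
        = Real.exp (-slabPot N u e x) * Real.exp (-(‖x‖ ^ 2 / 2)) := fun N => by
      rw [← Real.exp_add, gaussPot]; congr 1; ring
    simp_rw [e1]
    exact (tendsto_exp_neg_slabPot u e x).mul_const _

lemma rpow_slabs_le (hn : 1 ≤ n) (hu : ∀ k, ‖u k‖ = 1)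
    (he : ∀ t ∈ Set.Icc (0 : ℝ) 1, ∀ k, invWidth α β t k ^ 2 ≤ 2 / ((n : ℝ) + 1))
    {t : ℝ} (ht : t ∈ Set.Icc (0 : ℝ) 1) :
    (gibbs fun x : Euc n => ‖x‖ ^ 2 / 2).real (slabs u (invWidth α β 1)) ^ t
      * (gibbs fun x : Euc n => ‖x‖ ^ 2 / 2).real (slabs u (invWidth α β 0)) ^ (1 - t)
      ≤ (gibbs fun x : Euc n => ‖x‖ ^ 2 / 2).real (slabs u (invWidth α β t)) :=
  le_of_tendsto_of_tendsto'
    (((tendsto_integral_gaussPot u _).rpow_const (Or.inr ht.1)).mul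
      ((tendsto_integral_gaussPot u _).rpow_const (Or.inr (sub_nonneg.2 ht.2))))
    (tendsto_integral_gaussPot u _)
    fun N => rpow_integral_le hn N.cast_nonneg hu he ht

end SlabTime

section SupportFunction

variable {K L : Set (Euc n)} {r : ℝ}

lemma inner_le_suppFn (hK : IsCompact K) {x : Euc n} (hx : x ∈ K) (u : Euc n) :
    ⟪x, u⟫ ≤ suppFn K u := by
  rw [real_inner_comm]
  exact le_csSup ((hK.image (f := fun y => ⟪u, y⟫) (by fun_prop)).bddAbove)
    (Set.mem_image_of_mem _ hx)

lemma abs_inner_le_suppFn (hK : IsCompact K) (hsym : K = -K) {x : Euc n} (hx : x ∈ K)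
    (u : Euc n) : |⟪x, u⟫| ≤ suppFn K u := by
  have hx' : -x ∈ K := by rw [hsym]; simpa using hx
  have h := inner_le_suppFn hK hx' u
  rw [inner_neg_left] at h
  exact abs_le.2 ⟨by linarith, inner_le_suppFn hK hx u⟩

lemma le_suppFn_of_closedBall_subset (hK : IsCompact K) (hr : 0 ≤ r)
    (hKr : Metric.closedBall 0 r ⊆ K) {u : Euc n} (hu : ‖u‖ = 1) : r ≤ suppFn K u := by
  have h := inner_le_suppFn hK (x := r • u)
    (hKr (by simp [norm_smul, hu, abs_of_nonneg hr])) u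
  simpa [real_inner_smul_left, real_inner_self_eq_norm_sq, hu] using h

lemma invWidth_log_eq {ι : Type*} {a b : ι → ℝ} {k : ι} (ha : 0 < a k) (hb : 0 < b k) (t : ℝ) :
    invWidth (fun k => Real.log (b k)) (fun k => Real.log (a k) - Real.log (b k)) t k
      = (a k ^ t * b k ^ (1 - t))⁻¹ := by
  rw [invWidth, Real.exp_neg, Real.rpow_def_of_pos ha, Real.rpow_def_of_pos hb, ← Real.exp_add]
  congr 2
  ring

lemma subset_slabs {ι : Type*} (hK : IsCompact K) (hsym : K = -K) {u : ι → Euc n}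
    (hpos : ∀ k, 0 < suppFn K (u k)) : K ⊆ slabs u fun k => (suppFn K (u k))⁻¹ := by
  intro x hx k
  rw [abs_mul, abs_of_pos (inv_pos.2 (hpos k)), ← div_eq_mul_inv, div_le_one (hpos k)]
  exact abs_inner_le_suppFn hK hsym hx (u k)

/-- The log-Brunn-Minkowski inequality for `K`, `L` and finitely many directions. -/
lemma rpow_real_le_slabs {ι : Type*} [Fintype ι] (hn : 1 ≤ n) (hK : IsCompact K)
    (hL : IsCompact L) (hKsym : K = -K) (hLsym : L = -L)
    (hKr : Metric.closedBall 0 (Real.sqrt (((n : ℝ) + 1) / 2)) ⊆ K)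
    (hLr : Metric.closedBall 0 (Real.sqrt (((n : ℝ) + 1) / 2)) ⊆ L)
    {u : ι → Euc n} (hu : ∀ k, ‖u k‖ = 1) {t : ℝ} (ht : t ∈ Set.Icc (0 : ℝ) 1) :
    (gibbs fun x : Euc n => ‖x‖ ^ 2 / 2).real K ^ t
      * (gibbs fun x : Euc n => ‖x‖ ^ 2 / 2).real L ^ (1 - t)
      ≤ (gibbs fun x : Euc n => ‖x‖ ^ 2 / 2).real
        (slabs u fun k => (suppFn K (u k) ^ t * suppFn L (u k) ^ (1 - t))⁻¹) := by
  have := isFiniteMeasure_gibbs_half_norm_sq (n := n)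
  set r := Real.sqrt (((n : ℝ) + 1) / 2)
  have hr : 0 < r := Real.sqrt_pos.2 (by positivity)
  have hKu := fun k => le_suppFn_of_closedBall_subset hK hr.le hKr (hu k)
  have hLu := fun k => le_suppFn_of_closedBall_subset hL hr.le hLr (hu k)
  have hKp := fun k => hr.trans_le (hKu k)
  have hLp := fun k => hr.trans_le (hLu k)
  have hw : ∀ s, invWidth (fun k => Real.log (suppFn L (u k)))
      (fun k => Real.log (suppFn K (u k)) - Real.log (suppFn L (u k))) s
      = fun k => (suppFn K (u k) ^ s * suppFn L (u k) ^ (1 - s))⁻¹ := fun s =>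
    funext fun k => invWidth_log_eq (a := fun k => suppFn K (u k))
      (b := fun k => suppFn L (u k)) (hKp k) (hLp k) s
  have he : ∀ s ∈ Set.Icc (0 : ℝ) 1, ∀ k, invWidth (fun k => Real.log (suppFn L (u k)))
      (fun k => Real.log (suppFn K (u k)) - Real.log (suppFn L (u k))) s k ^ 2
      ≤ 2 / ((n : ℝ) + 1) := by
    intro s hs k
    have h : r ≤ suppFn K (u k) ^ s * suppFn L (u k) ^ (1 - s) := by
      calc r = r ^ s * r ^ (1 - s) := by rw [← Real.rpow_add hr]; simp
        _ ≤ _ := mul_le_mul (Real.rpow_le_rpow hr.le (hKu k) hs.1)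
          (Real.rpow_le_rpow hr.le (hLu k) (sub_nonneg.2 hs.2)) (by positivity)
          (Real.rpow_nonneg (hKp k).le _)
    have hr2 : r ^ 2 = ((n : ℝ) + 1) / 2 := Real.sq_sqrt (by positivity)
    rw [hw, inv_pow, ← inv_div ((n : ℝ) + 1) 2, ← hr2]
    exact inv_anti₀ (by positivity) (pow_le_pow_left₀ hr.le h 2)
  have hmain := rpow_slabs_le hn hu he ht
  simp only [hw, Real.rpow_one, Real.rpow_zero, sub_self, sub_zero, mul_one, one_mul] at hmain
  refine le_trans (mul_le_mul ?_ ?_ (Real.rpow_nonneg measureReal_nonneg _)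
    (Real.rpow_nonneg measureReal_nonneg _)) hmain
  · exact Real.rpow_le_rpow measureReal_nonneg
      (measureReal_mono (subset_slabs hK hKsym hKp)) ht.1
  · exact Real.rpow_le_rpow measureReal_nonneg
      (measureReal_mono (subset_slabs hL hLsym hLp)) (sub_nonneg.2 ht.2)

/-- Countably many constraints suffice to cut out a Wulff shape. -/
lemma exists_seq_unit_forall_inner_le (hn : 1 ≤ n) (f : Euc n → ℝ) :
    ∃ v : ℕ → Euc n, (∀ k, ‖v k‖ = 1) ∧
      ∀ x : Euc n, (∀ k, ⟪x, v k⟫ ≤ f (v k)) → ∀ u : Euc n, ‖u‖ = 1 → ⟪x, u⟫ ≤ f u := by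
  have hne : Nonempty {u : Euc n // ‖u‖ = 1} :=
    ⟨EuclideanSpace.single ⟨0, hn⟩ 1, by simp⟩
  obtain ⟨T, hT, hU⟩ := TopologicalSpace.isOpen_iUnion_countable
    (fun u : {u : Euc n // ‖u‖ = 1} => {x : Euc n | f u < ⟪x, (u : Euc n)⟫})
    fun u => isOpen_lt continuous_const (by fun_prop)
  obtain ⟨v, hv⟩ := (hT.insert hne.some).exists_eq_range (Set.insert_nonempty _ _)
  refine ⟨fun k => v k, fun k => (v k).2, fun x hx u hu => ?_⟩
  by_contra! hlt
  have hmem : x ∈ ⋃ u : {u : Euc n // ‖u‖ = 1}, {x : Euc n | f u < ⟪x, (u : Euc n)⟫} :=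
    Set.mem_iUnion.2 ⟨⟨u, hu⟩, hlt⟩
  rw [← hU] at hmem
  obtain ⟨w, hw, hxw⟩ := Set.mem_iUnion₂.1 hmem
  obtain ⟨k, rfl⟩ : w ∈ Set.range v := hv ▸ Set.mem_insert_of_mem _ hw
  exact absurd (hx k) (not_le.2 hxw)

lemma rpow_real_le_lpComb (hn : 1 ≤ n) (hK : IsCompact K)
    (hL : IsCompact L) (hKsym : K = -K) (hLsym : L = -L)
    (hKr : Metric.closedBall 0 (Real.sqrt (((n : ℝ) + 1) / 2)) ⊆ K)
    (hLr : Metric.closedBall 0 (Real.sqrt (((n : ℝ) + 1) / 2)) ⊆ L)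
    {t : ℝ} (ht : t ∈ Set.Icc (0 : ℝ) 1) :
    (gibbs fun x : Euc n => ‖x‖ ^ 2 / 2).real K ^ t
      * (gibbs fun x : Euc n => ‖x‖ ^ 2 / 2).real L ^ (1 - t)
      ≤ (gibbs fun x : Euc n => ‖x‖ ^ 2 / 2).real (lpComb 0 t K L) := by
  have := isFiniteMeasure_gibbs_half_norm_sq (n := n)
  set f : Euc n → ℝ := fun u => suppFn K u ^ t * suppFn L u ^ (1 - t)
  obtain ⟨v, hv, hvf⟩ := exists_seq_unit_forall_inner_le hn f
  have hr : 0 < Real.sqrt (((n : ℝ) + 1) / 2) := Real.sqrt_pos.2 (by positivity)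
  have hfp : ∀ k, 0 < f (v k) := fun k => mul_pos
    (Real.rpow_pos_of_pos (hr.trans_le (le_suppFn_of_closedBall_subset hK hr.le hKr (hv k))) _)
    (Real.rpow_pos_of_pos (hr.trans_le (le_suppFn_of_closedBall_subset hL hr.le hLr (hv k))) _)
  let S : ℕ → Set (Euc n) := fun m => slabs (fun k : Fin m => v k) fun k => (f (v k))⁻¹
  have hS : Antitone S := fun m m' hm x hx k => hx (Fin.castLE hm k)
  have hlim := tendsto_measure_iInter_atTop (μ := gibbs fun x : Euc n => ‖x‖ ^ 2 / 2)
    (fun m => (isClosed_slabs _ _).measurableSet.nullMeasurableSet) hS ⟨0, measure_ne_top _ _⟩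
  have hle := ge_of_tendsto' ((ENNReal.tendsto_toReal (measure_ne_top _ _)).comp hlim)
    fun m => rpow_real_le_slabs hn hK hL hKsym hLsym hKr hLr (fun k : Fin m => hv k) ht
  refine hle.trans (measureReal_mono fun x hx => ?_)
  rw [lpComb, if_pos rfl]
  refine hvf x fun k => ?_
  have h := Set.mem_iInter.1 hx (k + 1) (Fin.last k)
  have h' : ⟪x, v k⟫ * (f (v k))⁻¹ ≤ 1 := (le_abs_self _).trans h
  rwa [← div_eq_mul_inv, div_le_one (hfp k)] at h'

lemma gaussianMeasure_eq_smul_gibbs :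
    gaussianMeasure n = ENNReal.ofReal ((2 * Real.pi) ^ (-(n : ℝ) / 2)) •
      gibbs fun x : Euc n => ‖x‖ ^ 2 / 2 := by
  rw [gibbs, ← withDensity_smul' _ _ ENNReal.ofReal_ne_top, gaussianMeasure]
  congr 1
  ext x
  rw [Pi.smul_apply, smul_eq_mul, ← ENNReal.ofReal_mul (by positivity), neg_div _ (‖x‖ ^ 2)]

end SupportFunction

end

/-- Corollary 1.7(2): the Gaussian Log-Brunn-Minkowski inequality holds for all
origin-symmetric convex bodies `K, L` containing `√((n+1)/2)·B₂ⁿ`. -/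
theorem gaussian_log_BM (n : ℕ) (hn : 1 ≤ n)
    (K L : Set (Euc n)) (hK : IsConvexBody K) (hL : IsConvexBody L)
    (hKsym : K = -K) (hLsym : L = -L)
    (hKr : Metric.closedBall (0 : Euc n) (Real.sqrt (((n : ℝ) + 1) / 2)) ⊆ K)
    (hLr : Metric.closedBall (0 : Euc n) (Real.sqrt (((n : ℝ) + 1) / 2)) ⊆ L) :
    ∀ lam ∈ Set.Icc (0:ℝ) 1,
      gaussianMeasure n K ^ lam * gaussianMeasure n L ^ (1 - lam)
        ≤ gaussianMeasure n (lpComb 0 lam K L) := by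
  intro t ht
  have := isFiniteMeasure_gibbs_half_norm_sq (n := n)
  have h := ENNReal.ofReal_le_ofReal
    (rpow_real_le_lpComb hn hK.1 hL.1 hKsym hLsym hKr hLr ht)
  have ht' : 0 ≤ 1 - t := sub_nonneg.2 ht.2
  rw [ENNReal.ofReal_mul (Real.rpow_nonneg measureReal_nonneg _),
    ← ENNReal.ofReal_rpow_of_nonneg measureReal_nonneg ht.1,
    ← ENNReal.ofReal_rpow_of_nonneg measureReal_nonneg ht', ofReal_measureReal,
    ofReal_measureReal, ofReal_measureReal] at h
  rw [gaussianMeasure_eq_smul_gibbs]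
  set c := ENNReal.ofReal ((2 * Real.pi) ^ (-(n : ℝ) / 2))
  have hc : c ^ t * c ^ (1 - t) = c := by
    rw [← ENNReal.rpow_add_of_nonneg _ _ ht.1 ht', add_sub_cancel, ENNReal.rpow_one]
  simp only [Measure.smul_apply, smul_eq_mul]
  rw [ENNReal.mul_rpow_of_nonneg _ _ ht.1, ENNReal.mul_rpow_of_nonneg _ _ ht',
    mul_mul_mul_comm, hc]
  gcongr

end
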